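/- Let -3 ≤ γ ≤ 1. There exists a constant C > 0 such that for all Schwartz functions f, g, h : ℝ³ → ℝ one has both ∫_{ℝ³} Q(f,g)(v) h(v) dv ≤ C · ‖⟨v⟩⁵ f‖_{L²} · ‖g‖_{L²} · ‖h‖_{H²₅} and ∫_{ℝ³} Q(f,g)(v) h(v) dv ≤ C · ‖⟨v⟩⁵ f‖_{L²} · ‖⟨v⟩^{10} g‖_{L²} · ‖h‖_{H²_{-5}}, where ‖h‖²_{H²_ℓ} := Σ_{|β|≤2} ‖⟨v⟩^ℓ ∂^β h‖²_{L²(ℝ³)} (sum over all multi-indices β ∈ ℕ³ of order at most 2). -/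

import Mathlib

open Real MeasureTheory


noncomputable abbrev jap (v : EuclideanSpace ℝ (Fin 3)) : ℝ := Real.sqrt (2 + ‖v‖ ^ 2)

/-- The standard coordinate vector `e_i` in `ℝ³`. -/
noncomputable def e3 (i : Fin 3) : EuclideanSpace ℝ (Fin 3) := EuclideanSpace.single i 1

/-- The Landau projection matrix entries `a_{ij}(u) = |u|^{γ+2}(δ_{ij} - u_i u_j/|u|²)`. -/
noncomputable def Aent (γ : ℝ) (i j : Fin 3) (u : EuclideanSpace ℝ (Fin 3)) : ℝ :=
  ‖u‖ ^ (γ + 2) * ((if i = j then (1 : ℝ) else 0) - u i * u j / ‖u‖ ^ 2)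

/-- The Landau collision operator
`Q(g,f)(v) = ∇_v · ∫ Φ(v-v_*)(g(v_*) ∇_v f(v) - f(v) ∇_{v_*} g(v_*)) dv_*`. -/
noncomputable def LandauQ (γ : ℝ) (g f : EuclideanSpace ℝ (Fin 3) → ℝ)
    (v : EuclideanSpace ℝ (Fin 3)) : ℝ :=
  ∑ i : Fin 3, fderiv ℝ (fun u => ∫ w, ∑ j : Fin 3,
    Aent γ i j (u - w) * (g w * fderiv ℝ f u (e3 j) - f u * fderiv ℝ g w (e3 j))) v (e3 i)

/-- Partial derivative in the `i`-th velocity direction. -/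
noncomputable def pd (i : Fin 3) (f : EuclideanSpace ℝ (Fin 3) → ℝ) :
    EuclideanSpace ℝ (Fin 3) → ℝ :=
  fun v => fderiv ℝ f v (e3 i)

/-- The iterated partial derivative `∂^β` for a multi-index `β ∈ ℕ³`. -/
noncomputable def mderiv (β : Fin 3 → ℕ) (f : EuclideanSpace ℝ (Fin 3) → ℝ) :
    EuclideanSpace ℝ (Fin 3) → ℝ :=
  (pd 0)^[β 0] ((pd 1)^[β 1] ((pd 2)^[β 2] f))

/-- The finite set of multi-indices `β ∈ ℕ³` with `|β| ≤ 2`. -/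
def msetLe2 : Finset (Fin 3 → ℕ) :=
  (Fintype.piFinset fun _ : Fin 3 => Finset.range 3).filter fun β => β 0 + β 1 + β 2 ≤ 2

/-- Weighted `L²` norm `‖⟨v⟩^ℓ f‖_{L²}`. -/
noncomputable def wL2 (ℓ : ℝ) (f : EuclideanSpace ℝ (Fin 3) → ℝ) : ℝ :=
  Real.sqrt (∫ v, jap v ^ (2 * ℓ) * f v ^ 2)

/-- Squared weighted Sobolev norm `‖h‖²_{H²_ℓ} = Σ_{|β|≤2} ‖⟨v⟩^ℓ ∂^β h‖²_{L²}`. -/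
noncomputable def H2Sq (ℓ : ℝ) (h : EuclideanSpace ℝ (Fin 3) → ℝ) : ℝ :=
  ∑ β ∈ msetLe2, ∫ v, jap v ^ (2 * ℓ) * mderiv β h v ^ 2


open scoped LineDeriv SchwartzMap

abbrev V3 := EuclideanSpace ℝ (Fin 3)

/-- An integrable kernel on `ℝ³` with the singularity `|z|⁻²`. -/
noncomputable def singKer (z : V3) : ℝ := (‖z‖ ^ 2)⁻¹ * ((1 + ‖z‖) ^ 4)⁻¹

lemma singKer_nonneg (z : V3) : 0 ≤ singKer z := by unfold singKer; positivity

lemma measurable_singKer : Measurable singKer := by unfold singKer; fun_prop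

lemma integrable_singKer : Integrable singKer := by
  have h := (integrable_fun_norm_addHaar (volume : Measure V3)
    (f := fun r : ℝ => (r ^ 2)⁻¹ * ((1 + r) ^ 4)⁻¹)).2 ?_
  · exact h
  have h1 : Integrable (fun r : ℝ => (1 + ‖r‖) ^ (-(4 : ℝ))) :=
    integrable_one_add_norm (by simp)
  refine (h1.integrableOn (s := Set.Ioi 0)).congr_fun (fun r hr => ?_) measurableSet_Ioi
  have hr : 0 < r := hr
  have h3 : Module.finrank ℝ V3 - 1 = 2 := by simp
  simp only [h3, smul_eq_mul, Real.norm_eq_abs, abs_of_pos hr]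
  rw [Real.rpow_neg (by positivity), show (4 : ℝ) = ((4 : ℕ) : ℝ) by norm_num, Real.rpow_natCast]
  field_simp

/-- Kernels with singularity at most `|z|⁻²` and growth at most `|z|³`. -/
structure IsSingKernel (A : V3 → ℝ) : Prop where
  meas : Measurable A
  bound : ∃ M, ∀ z, |A z| ≤ M * ((‖z‖ ^ 2)⁻¹ * (1 + ‖z‖) ^ 5)

lemma SchwartzMap.exists_one_add_pow_mul_le {F : Type*} [NormedAddCommGroup F] [NormedSpace ℝ F]
    (f : 𝓢(V3, F)) (k : ℕ) : ∃ C, 0 ≤ C ∧ ∀ x, (1 + ‖x‖) ^ k * ‖f x‖ ≤ C := by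
  refine ⟨2 ^ k * (((Finset.Iic (k, 0)).sup fun m => SchwartzMap.seminorm ℝ m.1 m.2) f),
    by positivity, fun x => ?_⟩
  have := f.one_add_le_sup_seminorm_apply (𝕜 := ℝ) (m := (k, 0)) le_rfl le_rfl x
  simpa using this

lemma IsSingKernel.exists_bound {A : V3 → ℝ} (hA : IsSingKernel A) {F : Type*}
    [NormedAddCommGroup F] [NormedSpace ℝ F] (f : 𝓢(V3, F)) :
    ∃ C, 0 ≤ C ∧ ∀ u z, ‖A z • f (u - z)‖ ≤ C * (1 + ‖u‖) ^ 9 * singKer z := by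
  obtain ⟨M, hM⟩ := hA.bound
  obtain ⟨C, hC, hf⟩ := f.exists_one_add_pow_mul_le 9
  refine ⟨|M| * C, by positivity, fun u z => ?_⟩
  have h1 : ‖f (u - z)‖ ≤ C * (1 + ‖u‖) ^ 9 * ((1 + ‖z‖) ^ 9)⁻¹ := by
    have h2 : 1 + ‖z‖ ≤ (1 + ‖u‖) * (1 + ‖u - z‖) := by
      have : ‖z‖ ≤ ‖u‖ + ‖u - z‖ := by simpa using norm_sub_le u (u - z)
      nlinarith [norm_nonneg u, norm_nonneg (u - z), mul_nonneg (norm_nonneg u) (norm_nonneg (u - z))]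
    have h3 : (1 + ‖z‖) ^ 9 ≤ (1 + ‖u‖) ^ 9 * (1 + ‖u - z‖) ^ 9 := by
      rw [← mul_pow]; gcongr
    rw [← div_eq_mul_inv, le_div_iff₀ (by positivity)]
    calc ‖f (u - z)‖ * (1 + ‖z‖) ^ 9
        ≤ ‖f (u - z)‖ * ((1 + ‖u‖) ^ 9 * (1 + ‖u - z‖) ^ 9) := by gcongr
      _ = ((1 + ‖u - z‖) ^ 9 * ‖f (u - z)‖) * (1 + ‖u‖) ^ 9 := by ring
      _ ≤ _ := by gcongr; exact hf _
  rw [norm_smul, Real.norm_eq_abs]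
  calc |A z| * ‖f (u - z)‖
      ≤ (|M| * ((‖z‖ ^ 2)⁻¹ * (1 + ‖z‖) ^ 5)) * (C * (1 + ‖u‖) ^ 9 * ((1 + ‖z‖) ^ 9)⁻¹) := by
        gcongr
        exact (hM z).trans (by gcongr; exact le_abs_self M)
    _ = _ := by unfold singKer; field_simp

lemma IsSingKernel.integrable {A : V3 → ℝ} (hA : IsSingKernel A) {F : Type*}
    [NormedAddCommGroup F] [NormedSpace ℝ F] (f : 𝓢(V3, F)) (u : V3) :
    Integrable (fun z => A z • f (u - z)) := by
  obtain ⟨C, -, h⟩ := hA.exists_bound f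
  refine (integrable_singKer.const_mul (C * (1 + ‖u‖) ^ 9)).mono' ?_ (.of_forall (h u))
  exact hA.meas.aestronglyMeasurable.smul
    (f.continuous.comp (continuous_const.sub continuous_id)).aestronglyMeasurable

/-- The `i`-th partial derivative of a Schwartz function. -/
noncomputable def sd (i : Fin 3) (f : 𝓢(V3, ℝ)) : 𝓢(V3, ℝ) := ∂_{e3 i} f

lemma sd_apply (i : Fin 3) (f : 𝓢(V3, ℝ)) (v : V3) : sd i f v = fderiv ℝ f v (e3 i) :=
  SchwartzMap.lineDerivOp_apply_eq_fderiv _ _ _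

/-- Convolution of a kernel with a function. -/
noncomputable def kconv (A : V3 → ℝ) (f : V3 → ℝ) (u : V3) : ℝ := ∫ w, A (u - w) * f w

lemma kconv_eq (A f : V3 → ℝ) (u : V3) : kconv A f u = ∫ z, A z * f (u - z) := by
  rw [kconv, ← integral_sub_left_eq_self _ volume u]; simp

lemma IsSingKernel.integrable_mul {A : V3 → ℝ} (hA : IsSingKernel A) (f : 𝓢(V3, ℝ)) (u : V3) :
    Integrable (fun w => A (u - w) * f w) := by
  have := (hA.integrable f u).comp_sub_left u
  simpa using this

lemma IsSingKernel.abs_kconv_le {A : V3 → ℝ} (hA : IsSingKernel A) (f : 𝓢(V3, ℝ)) :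
    ∃ C, 0 ≤ C ∧ ∀ u, |kconv A f u| ≤ C * (1 + ‖u‖) ^ 9 := by
  obtain ⟨C, hC, h⟩ := hA.exists_bound f
  refine ⟨C * ∫ z, singKer z, mul_nonneg hC (integral_nonneg singKer_nonneg), fun u => ?_⟩
  rw [kconv_eq, ← Real.norm_eq_abs]
  refine (norm_integral_le_of_norm_le (integrable_singKer.const_mul (C * (1 + ‖u‖) ^ 9))
    (.of_forall (h u))).trans_eq ?_
  rw [integral_const_mul]; ring

lemma IsSingKernel.hasFDerivAt_kconv {A : V3 → ℝ} (hA : IsSingKernel A) (f : 𝓢(V3, ℝ)) (u : V3) :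
    ∃ L : V3 →L[ℝ] ℝ, HasFDerivAt (kconv A f) L u ∧ ∀ i, L (e3 i) = kconv A (sd i f) u := by
  let f' := SchwartzMap.fderivCLM ℝ V3 ℝ f
  obtain ⟨C, hC, h⟩ := hA.exists_bound f'
  refine ⟨∫ z, A z • f' (u - z), ?_, fun i => ?_⟩
  · have : kconv A f = fun u => ∫ z, A z * f (u - z) := funext fun u => kconv_eq A f u
    rw [this]
    refine hasFDerivAt_integral_of_dominated_of_fderiv_le (𝕜 := ℝ)
      (bound := fun z => C * (2 + ‖u‖) ^ 9 * singKer z)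
      (F' := fun x z => A z • f' (x - z)) (Metric.ball_mem_nhds u one_pos) ?_ ?_ ?_ ?_ ?_ ?_
    · exact .of_forall fun x => (hA.integrable f x).aestronglyMeasurable
    · exact hA.integrable f u
    · exact (hA.integrable f' u).aestronglyMeasurable
    · refine .of_forall fun z x hx => (h x z).trans ?_
      have hx' : ‖x‖ ≤ 1 + ‖u‖ := by
        have h1 : ‖x - u‖ < 1 := by simpa [dist_eq_norm] using hx
        have h2 : ‖x‖ ≤ ‖x - u‖ + ‖u‖ := by simpa using norm_add_le (x - u) u
        linarith
      have := singKer_nonneg z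
      gcongr ?_ * ?_ ^ 9 * ?_
      linarith
    · exact integrable_singKer.const_mul _
    · refine .of_forall fun z x _ => ?_
      have h1 : HasFDerivAt f (f' (x - z)) (x - z) := f.hasFDerivAt (x - z)
      have h2 := (h1.comp x ((hasFDerivAt_id x).sub_const z)).const_mul (A z)
      simpa [Function.comp_def] using h2
  · rw [ContinuousLinearMap.integral_apply (hA.integrable f' u), kconv_eq]
    simp [f', sd_apply]

lemma IsSingKernel.continuous_kconv {A : V3 → ℝ} (hA : IsSingKernel A) (f : 𝓢(V3, ℝ)) :
    Continuous (kconv A f) := by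
  refine continuous_iff_continuousAt.2 fun u => ?_
  obtain ⟨L, hL, -⟩ := hA.hasFDerivAt_kconv f u
  exact hL.continuousAt

lemma SchwartzMap.integrable_mul_of_le (s : 𝓢(V3, ℝ)) {c : V3 → ℝ} (hc : AEStronglyMeasurable c)
    {C : ℝ} {k : ℕ} (h : ∀ u, |c u| ≤ C * (1 + ‖u‖) ^ k) : Integrable (fun v => c v * s v) := by
  obtain ⟨D, hD, hs⟩ := s.exists_one_add_pow_mul_le (k + 4)
  have h1 : Integrable (fun r : V3 => (1 + ‖r‖) ^ (-(4 : ℝ))) :=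
    integrable_one_add_norm (by norm_num)
  refine (h1.const_mul (|C| * D)).mono' (hc.mul s.continuous.aestronglyMeasurable)
    (.of_forall fun v => ?_)
  rw [Real.rpow_neg (by positivity), show (4 : ℝ) = ((4 : ℕ) : ℝ) by norm_num, Real.rpow_natCast,
    ← div_eq_mul_inv, le_div_iff₀ (by positivity), norm_mul, Real.norm_eq_abs]
  calc |c v| * ‖s v‖ * (1 + ‖v‖) ^ 4 ≤ (|C| * (1 + ‖v‖) ^ k) * ‖s v‖ * (1 + ‖v‖) ^ 4 := by
        gcongr
        exact (h v).trans (by gcongr; exact le_abs_self C)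
    _ = |C| * ((1 + ‖v‖) ^ (k + 4) * ‖s v‖) := by ring
    _ ≤ _ := by gcongr; exact hs v

/-- Pointwise product of Schwartz functions. -/
noncomputable def schwartzMul (s t : 𝓢(V3, ℝ)) : 𝓢(V3, ℝ) := SchwartzMap.smulLeftCLM ℝ s t

lemma schwartzMul_apply (s t : 𝓢(V3, ℝ)) (v : V3) : schwartzMul s t v = s v * t v := by
  simp [schwartzMul, SchwartzMap.smulLeftCLM_apply_apply s.hasTemperateGrowth]

lemma IsSingKernel.integrable_kconv_mul_mul {A : V3 → ℝ} (hA : IsSingKernel A)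
    (f s t : 𝓢(V3, ℝ)) : Integrable (fun v => kconv A f v * s v * t v) := by
  obtain ⟨C, -, h⟩ := hA.abs_kconv_le f
  simpa [schwartzMul_apply, mul_assoc] using
    (schwartzMul s t).integrable_mul_of_le (hA.continuous_kconv f).aestronglyMeasurable h

lemma IsSingKernel.integral_product_rule {A : V3 → ℝ} (hA : IsSingKernel A)
    (f s t : 𝓢(V3, ℝ)) (i : Fin 3) :
    (∫ v, kconv A (sd i f) v * s v * t v) + (∫ v, kconv A f v * (sd i s) v * t v)
      + (∫ v, kconv A f v * s v * (sd i t) v) = 0 := by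
  have hd : ∀ v, DifferentiableAt ℝ (fun v => kconv A f v * s v) v ∧
      fderiv ℝ (fun v => kconv A f v * s v) v (e3 i) =
        kconv A (sd i f) v * s v + kconv A f v * (sd i s) v := by
    intro v
    obtain ⟨L, hL, hLe⟩ := hA.hasFDerivAt_kconv f v
    have h := hL.fun_mul (s.hasFDerivAt v)
    refine ⟨h.differentiableAt, ?_⟩
    rw [h.fderiv]
    simp [hLe, sd_apply]
    ring
  have h0 := hA.integrable_kconv_mul_mul (sd i f) s t
  have h1 := hA.integrable_kconv_mul_mul f (sd i s) t
  have h2 := hA.integrable_kconv_mul_mul f s (sd i t)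
  have key := integral_mul_fderiv_eq_neg_fderiv_mul_of_integrable (𝕜 := ℝ) (μ := volume)
    (f := fun v => kconv A f v * s v) (g := t) (v := e3 i)
    (by simp only [(hd _).2, add_mul]; exact h0.add h1)
    (by simpa only [sd_apply] using h2)
    (hA.integrable_kconv_mul_mul f s t) (fun v _ => (hd v).1) (fun v _ => t.differentiableAt)
  simp only [(hd _).2, add_mul] at key
  rw [integral_add h0 h1] at key
  simp only [sd_apply] at key ⊢
  linarith

/-- The kernel `(ε + |u|²)^{γ/2} (|u|² δ_{ij} - u_i u_j)`, a regularization of `Aent`. -/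
noncomputable def regA (γ ε : ℝ) (i j : Fin 3) (u : V3) : ℝ :=
  (ε + ‖u‖ ^ 2) ^ (γ / 2) * (‖u‖ ^ 2 * (if i = j then (1 : ℝ) else 0) - u i * u j)

/-- The kernel `(ε + |u|²)^{γ/2} u_i`; the divergence of `regA` is `-2` times it. -/
noncomputable def regB (γ ε : ℝ) (i : Fin 3) (u : V3) : ℝ :=
  (ε + ‖u‖ ^ 2) ^ (γ / 2) * u i

lemma abs_coord_le (u : V3) (i : Fin 3) : |u i| ≤ ‖u‖ := by
  simpa using PiLp.norm_apply_le u i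

lemma rpow_half_le {γ ε r : ℝ} (hγl : -3 ≤ γ) (hγu : γ ≤ 1) (hε : 0 ≤ ε) (hε1 : ε ≤ 1)
    (hr : 0 < r) : (ε + r ^ 2) ^ (γ / 2) ≤ (r ^ 3)⁻¹ + 1 + r := by
  have hx : 0 < ε + r ^ 2 := by positivity
  have h3 : 0 < (r ^ 3)⁻¹ := by positivity
  rcases le_total (ε + r ^ 2) 1 with h | h
  · calc (ε + r ^ 2) ^ (γ / 2) ≤ (ε + r ^ 2) ^ (-(3 / 2 : ℝ)) :=
          Real.rpow_le_rpow_of_exponent_ge hx h (by linarith)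
      _ ≤ (r ^ 2) ^ (-(3 / 2 : ℝ)) :=
          Real.rpow_le_rpow_of_nonpos (by positivity) (by linarith) (by norm_num)
      _ = (r ^ 3)⁻¹ := by
          rw [Real.rpow_neg (by positivity), ← Real.rpow_natCast r 2, ← Real.rpow_mul hr.le,
            ← Real.rpow_natCast r 3]
          norm_num
      _ ≤ _ := by linarith
  · calc (ε + r ^ 2) ^ (γ / 2) ≤ (ε + r ^ 2) ^ (1 / 2 : ℝ) :=
          Real.rpow_le_rpow_of_exponent_le h (by linarith)
      _ = √(ε + r ^ 2) := (Real.sqrt_eq_rpow _).symm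
      _ ≤ 1 + r := Real.sqrt_le_iff.2 ⟨by positivity, by nlinarith⟩
      _ ≤ _ := by linarith

section bounds

variable {γ ε : ℝ} (hγl : -3 ≤ γ) (hγu : γ ≤ 1) (hε : 0 ≤ ε) (hε1 : ε ≤ 1)

include hγl hγu hε hε1

lemma abs_regA_le (i j : Fin 3) (u : V3) :
    |regA γ ε i j u| ≤ 2 * (‖u‖⁻¹ + ‖u‖ ^ 2 + ‖u‖ ^ 3) := by
  rcases eq_or_ne u 0 with rfl | hu
  · simp [regA]
  have hr : 0 < ‖u‖ := norm_pos_iff.2 hu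
  have h1 := rpow_half_le hγl hγu hε hε1 hr
  have h2 : |‖u‖ ^ 2 * (if i = j then (1 : ℝ) else 0) - u i * u j| ≤ 2 * ‖u‖ ^ 2 := by
    refine (abs_sub _ _).trans ?_
    have : |u i * u j| ≤ ‖u‖ * ‖u‖ := by
      rw [abs_mul]; gcongr <;> exact abs_coord_le _ _
    have : |‖u‖ ^ 2 * (if i = j then (1 : ℝ) else 0)| ≤ ‖u‖ ^ 2 := by
      split_ifs <;> simp
    linarith
  rw [regA, abs_mul, abs_of_pos (Real.rpow_pos_of_pos (by positivity) _)]
  calc _ ≤ ((‖u‖ ^ 3)⁻¹ + 1 + ‖u‖) * (2 * ‖u‖ ^ 2) := by gcongr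
    _ = _ := by field_simp

lemma abs_regB_le (i : Fin 3) (u : V3) :
    |regB γ ε i u| ≤ (‖u‖ ^ 2)⁻¹ + ‖u‖ + ‖u‖ ^ 2 := by
  rcases eq_or_ne u 0 with rfl | hu
  · simp [regB]
  have hr : 0 < ‖u‖ := norm_pos_iff.2 hu
  have h1 := rpow_half_le hγl hγu hε hε1 hr
  rw [regB, abs_mul, abs_of_pos (Real.rpow_pos_of_pos (by positivity) _)]
  calc _ ≤ ((‖u‖ ^ 3)⁻¹ + 1 + ‖u‖) * ‖u‖ := by gcongr; exact abs_coord_le _ _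
    _ = _ := by field_simp

lemma abs_regA_le_singular (i j : Fin 3) (u : V3) :
    |regA γ ε i j u| ≤ 2 * ((‖u‖ ^ 2)⁻¹ * (1 + ‖u‖) ^ 5) := by
  rcases eq_or_ne u 0 with rfl | hu
  · simp [regA]
  refine (abs_regA_le hγl hγu hε hε1 i j u).trans ?_
  have hr : 0 < ‖u‖ := norm_pos_iff.2 hu
  gcongr
  have : ‖u‖⁻¹ + ‖u‖ ^ 2 + ‖u‖ ^ 3 = (‖u‖ ^ 2)⁻¹ * (‖u‖ + ‖u‖ ^ 4 + ‖u‖ ^ 5) := by field_simp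
  rw [this]
  gcongr
  have : 0 ≤ 1 + 4 * ‖u‖ + 10 * ‖u‖ ^ 2 + 10 * ‖u‖ ^ 3 + 4 * ‖u‖ ^ 4 := by positivity
  linarith [show (1 + ‖u‖) ^ 5 = ‖u‖ + ‖u‖ ^ 4 + ‖u‖ ^ 5 +
    (1 + 4 * ‖u‖ + 10 * ‖u‖ ^ 2 + 10 * ‖u‖ ^ 3 + 4 * ‖u‖ ^ 4) by ring]

lemma abs_regB_le_singular (i : Fin 3) (u : V3) :
    |regB γ ε i u| ≤ 1 * ((‖u‖ ^ 2)⁻¹ * (1 + ‖u‖) ^ 5) := by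
  rcases eq_or_ne u 0 with rfl | hu
  · simp [regB]
  refine (abs_regB_le hγl hγu hε hε1 i u).trans ?_
  have hr : 0 < ‖u‖ := norm_pos_iff.2 hu
  rw [one_mul]
  have : (‖u‖ ^ 2)⁻¹ + ‖u‖ + ‖u‖ ^ 2 = (‖u‖ ^ 2)⁻¹ * (1 + ‖u‖ ^ 3 + ‖u‖ ^ 4) := by field_simp
  rw [this]
  gcongr
  have : 0 ≤ 5 * ‖u‖ + 10 * ‖u‖ ^ 2 + 9 * ‖u‖ ^ 3 + 4 * ‖u‖ ^ 4 + ‖u‖ ^ 5 := by positivity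
  linarith [show (1 + ‖u‖) ^ 5 = 1 + ‖u‖ ^ 3 + ‖u‖ ^ 4 +
    (5 * ‖u‖ + 10 * ‖u‖ ^ 2 + 9 * ‖u‖ ^ 3 + 4 * ‖u‖ ^ 4 + ‖u‖ ^ 5) by ring]

lemma isSingKernel_regA (i j : Fin 3) : IsSingKernel (regA γ ε i j) :=
  ⟨by unfold regA; fun_prop, 2, abs_regA_le_singular hγl hγu hε hε1 i j⟩

lemma isSingKernel_regB (i : Fin 3) : IsSingKernel (regB γ ε i) :=
  ⟨by unfold regB; fun_prop, 1, abs_regB_le_singular hγl hγu hε hε1 i⟩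

end bounds

lemma Aent_eq_regA (γ : ℝ) (i j : Fin 3) {u : V3} (hu : u ≠ 0) :
    Aent γ i j u = regA γ 0 i j u := by
  have hr : 0 < ‖u‖ := norm_pos_iff.2 hu
  rw [Aent, regA, zero_add, ← Real.rpow_natCast ‖u‖ 2, ← Real.rpow_mul hr.le,
    Real.rpow_add hr]
  simp only [Nat.cast_ofNat, mul_div_cancel₀ γ (two_ne_zero), Real.rpow_ofNat]
  field_simp

lemma hasTemperateGrowth_const_sub (v : V3) :
    Function.HasTemperateGrowth (fun w : V3 => v - w) := by
  simpa [Pi.sub_def] using (Function.HasTemperateGrowth.const v).sub .id'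

lemma hasTemperateGrowth_coord_sub (v : V3) (i : Fin 3) :
    Function.HasTemperateGrowth (fun w : V3 => (v - w) i) :=
  ((EuclideanSpace.proj i : V3 →L[ℝ] ℝ).hasTemperateGrowth).comp (hasTemperateGrowth_const_sub v)

lemma hasTemperateGrowth_add_norm_sq_rpow {c : ℝ} (hc : 0 < c) (s : ℝ) :
    Function.HasTemperateGrowth (fun w : V3 => (c + ‖w‖ ^ 2) ^ s) := by
  have h2 : Function.HasTemperateGrowth (fun w : V3 => (√c)⁻¹ • w) :=
    ((√c)⁻¹ • ContinuousLinearMap.id ℝ V3).hasTemperateGrowth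
  have h3 : (fun w : V3 => (c + ‖w‖ ^ 2) ^ s) =
      (fun _ => c ^ s) * ((fun x : V3 => (1 + ‖x‖ ^ 2) ^ s) ∘ fun w => (√c)⁻¹ • w) := by
    ext w
    simp only [Pi.mul_apply, Function.comp_apply]
    rw [← Real.mul_rpow hc.le (by positivity), norm_smul, mul_pow, norm_inv, inv_pow,
      Real.norm_of_nonneg (Real.sqrt_nonneg c), Real.sq_sqrt hc.le]
    congr 1
    field_simp
  rw [h3]
  exact (Function.HasTemperateGrowth.const (E := V3) (c ^ s)).mul
    ((Function.hasTemperateGrowth_one_add_norm_sq_rpow V3 s).comp h2)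

lemma SchwartzMap.integral_fderiv_eq_zero (S : 𝓢(V3, ℝ)) (e : V3) :
    ∫ w, fderiv ℝ S w e = 0 := by
  have h : Integrable (fun w => fderiv ℝ S w e) := by
    simp only [← SchwartzMap.lineDerivOp_apply_eq_fderiv]
    exact (∂_{e} S : 𝓢(V3, ℝ)).integrable
  have := integral_mul_fderiv_eq_neg_fderiv_mul_of_integrable (𝕜 := ℝ) (μ := volume)
    (f := fun _ : V3 => (1 : ℝ)) (g := S) (v := e)
    (by simp) (by simpa using h) (by simpa using S.integrable)
    (fun v _ => by fun_prop) (fun v _ => S.differentiableAt)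
  simpa using this

lemma hasFDerivAt_rpow_mul_coord {ε : ℝ} (hε : 0 < ε) (s : ℝ) (v w : V3) (i j k : Fin 3) (d : ℝ) :
    ∃ L : V3 →L[ℝ] ℝ, HasFDerivAt (fun w : V3 => (ε + ‖v - w‖ ^ 2) ^ s *
        (‖v - w‖ ^ 2 * d - (v - w) i * (v - w) j)) L w ∧
      L (e3 k) = -(s * (ε + ‖v - w‖ ^ 2) ^ (s - 1) * (2 * (v - w) k) *
          (‖v - w‖ ^ 2 * d - (v - w) i * (v - w) j)
        + (ε + ‖v - w‖ ^ 2) ^ s * (2 * (v - w) k * d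
          - ((if k = i then (1 : ℝ) else 0) * (v - w) j
            + (v - w) i * (if k = j then (1 : ℝ) else 0)))) := by
  have hs : HasFDerivAt (fun w : V3 => v - w) (-ContinuousLinearMap.id ℝ V3) w :=
    (hasFDerivAt_id w).const_sub v
  have hn := hs.norm_sq
  have hc : ∀ i, HasFDerivAt (fun w : V3 => (v - w) i)
      ((EuclideanSpace.proj i : V3 →L[ℝ] ℝ).comp (-ContinuousLinearMap.id ℝ V3)) w := fun i =>
    ((EuclideanSpace.proj i : V3 →L[ℝ] ℝ).hasFDerivAt).comp w hs
  have hp := (hn.const_add ε).rpow_const (p := s) (Or.inl (by positivity))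
  have h := hp.mul ((hn.mul_const d).sub ((hc i).mul (hc j)))
  refine ⟨_, h, ?_⟩
  simp [e3, EuclideanSpace.inner_single_right, eq_comm (a := k)]
  ring

lemma sum_integral_regA_of_pos {γ ε : ℝ} (hγl : -3 ≤ γ) (hγu : γ ≤ 1) (hε : 0 < ε) (hε1 : ε ≤ 1)
    (f : 𝓢(V3, ℝ)) (i : Fin 3) (v : V3) :
    ∑ j, kconv (regA γ ε i j) (sd j f) v = -2 * kconv (regB γ ε i) f v := by
  have hA := isSingKernel_regA hγl hγu hε.le hε1
  have hB := isSingKernel_regB hγl hγu hε.le hε1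
  have hT : ∀ j, Function.HasTemperateGrowth (fun w => regA γ ε i j (v - w)) := fun j =>
    ((hasTemperateGrowth_add_norm_sq_rpow hε (γ / 2)).comp (hasTemperateGrowth_const_sub v)).mul
      ((((Function.hasTemperateGrowth_norm_sq V3).comp (hasTemperateGrowth_const_sub v)).mul
        (.const _)).sub ((hasTemperateGrowth_coord_sub v i).mul (hasTemperateGrowth_coord_sub v j)))
  let S : Fin 3 → 𝓢(V3, ℝ) := fun j => SchwartzMap.smulLeftCLM ℝ (fun w => regA γ ε i j (v - w)) f
  have hS : ∀ j, (S j : V3 → ℝ) = fun w => regA γ ε i j (v - w) * f w := fun j => by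
    ext w; simp [S, SchwartzMap.smulLeftCLM_apply_apply (hT j)]
  have hsum : ∀ w, ∑ j, fderiv ℝ (S j) w (e3 j) =
      ∑ j, regA γ ε i j (v - w) * sd j f w + 2 * (regB γ ε i (v - w) * f w) := by
    intro w
    choose L hL hLe using fun j => hasFDerivAt_rpow_mul_coord hε (γ / 2) v w i j j
      (if i = j then (1 : ℝ) else 0)
    have hd : ∀ j, fderiv ℝ (S j) w (e3 j) =
        regA γ ε i j (v - w) * sd j f w + f w * L j (e3 j) := fun j => by
      have := (hL j).fun_mul (f.hasFDerivAt w)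
      rw [hS]
      unfold regA
      rw [this.fderiv]
      simp [sd_apply]
    have hn : ‖v - w‖ ^ 2 = (v - w) 0 ^ 2 + (v - w) 1 ^ 2 + (v - w) 2 ^ 2 := by
      rw [EuclideanSpace.real_norm_sq_eq, Fin.sum_univ_three]
    simp only [hd, hLe, Finset.sum_add_distrib, add_right_inj, regB, ← Finset.mul_sum]
    generalize (ε + ‖v - w‖ ^ 2) ^ (γ / 2) = P
    generalize (ε + ‖v - w‖ ^ 2) ^ (γ / 2 - 1) = P'
    rw [hn, Fin.sum_univ_three]
    fin_cases i <;> simp <;> ring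
  have h1 : ∫ w, ∑ j, fderiv ℝ (S j) w (e3 j) = 0 := by
    rw [integral_finsetSum]
    · simp [SchwartzMap.integral_fderiv_eq_zero]
    · intro j _
      simpa only [← sd_apply] using (sd j (S j)).integrable
  simp only [hsum] at h1
  rw [integral_add (integrable_finsetSum _ fun j _ => (hA i j).integrable_mul _ _)
    (((hB i).integrable_mul _ _).const_mul _), integral_finsetSum _
    fun j _ => (hA i j).integrable_mul _ _, integral_const_mul] at h1
  simp only [kconv]
  linarith

lemma tendsto_kconv_of_regularization {K : ℕ → V3 → ℝ} {A : V3 → ℝ} (hK : ∀ n, Measurable (K n))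
    {M : ℝ} (hb : ∀ n u, |K n u| ≤ M * ((‖u‖ ^ 2)⁻¹ * (1 + ‖u‖) ^ 5))
    (hlim : ∀ u ≠ 0, Filter.Tendsto (fun n => K n u) Filter.atTop (nhds (A u)))
    (f : 𝓢(V3, ℝ)) (v : V3) :
    Filter.Tendsto (fun n => kconv (K n) f v) Filter.atTop (nhds (kconv A f v)) := by
  have hD : IsSingKernel (fun u : V3 => M * ((‖u‖ ^ 2)⁻¹ * (1 + ‖u‖) ^ 5)) :=
    ⟨by fun_prop, |M|, fun z => by
      rw [abs_mul, abs_of_nonneg (a := (‖z‖ ^ 2)⁻¹ * (1 + ‖z‖) ^ 5) (by positivity)]⟩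
  refine tendsto_integral_of_dominated_convergence _ (fun n => ?_) (hD.integrable_mul f v).norm
    (fun n => .of_forall fun w => ?_) ?_
  · exact (((hK n).comp (measurable_const.sub measurable_id)).mul
      f.continuous.measurable).aestronglyMeasurable
  · rw [norm_mul, norm_mul]
    gcongr
    exact (hb n _).trans (le_abs_self _)
  · have : ∀ᵐ w : V3, w ≠ v := Measure.ae_ne _ _
    filter_upwards [this] with w hw
    exact (hlim _ (sub_ne_zero.2 hw.symm)).mul_const _

lemma tendsto_add_norm_sq_rpow (s : ℝ) {u : V3} (hu : u ≠ 0) :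
    Filter.Tendsto (fun n : ℕ => (1 / ((n : ℝ) + 1) + ‖u‖ ^ 2) ^ s) Filter.atTop
      (nhds ((0 + ‖u‖ ^ 2) ^ s)) := by
  have hr : 0 < ‖u‖ := norm_pos_iff.2 hu
  exact (tendsto_one_div_add_atTop_nhds_zero_nat.add_const _).rpow_const (Or.inl (by positivity))

lemma sum_kconv_regA {γ : ℝ} (hγl : -3 ≤ γ) (hγu : γ ≤ 1) (f : 𝓢(V3, ℝ)) (i : Fin 3) (v : V3) :
    ∑ j, kconv (regA γ 0 i j) (sd j f) v = -2 * kconv (regB γ 0 i) f v := by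
  have hp : ∀ n : ℕ, (0 : ℝ) < 1 / ((n : ℝ) + 1) := fun n => by positivity
  have hp1 : ∀ n : ℕ, 1 / ((n : ℝ) + 1) ≤ (1 : ℝ) := fun n => by
    rw [div_le_one (by positivity)]; linarith [(n.cast_nonneg : (0 : ℝ) ≤ n)]
  have hA : Filter.Tendsto (fun n : ℕ => ∑ j, kconv (regA γ (1 / ((n : ℝ) + 1)) i j) (sd j f) v)
      Filter.atTop (nhds (∑ j, kconv (regA γ 0 i j) (sd j f) v)) :=
    tendsto_finsetSum _ fun j _ => tendsto_kconv_of_regularization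
      (fun n => (isSingKernel_regA hγl hγu (hp n).le (hp1 n) i j).meas)
      (fun n => abs_regA_le_singular hγl hγu (hp n).le (hp1 n) i j)
      (fun u hu => (tendsto_add_norm_sq_rpow _ hu).mul_const _) _ _
  have hB : Filter.Tendsto (fun n : ℕ => -2 * kconv (regB γ (1 / ((n : ℝ) + 1)) i) f v)
      Filter.atTop (nhds (-2 * kconv (regB γ 0 i) f v)) :=
    (tendsto_kconv_of_regularization
      (fun n => (isSingKernel_regB hγl hγu (hp n).le (hp1 n) i).meas)
      (fun n => abs_regB_le_singular hγl hγu (hp n).le (hp1 n) i)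
      (fun u hu => (tendsto_add_norm_sq_rpow _ hu).mul_const _) _ _).const_mul _
  simp only [sum_integral_regA_of_pos hγl hγu (hp _) (hp1 _)] at hA
  exact tendsto_nhds_unique hA hB

section weak

variable {γ : ℝ} (hγl : -3 ≤ γ) (hγu : γ ≤ 1) (f g h : 𝓢(V3, ℝ))

include hγl hγu

lemma landau_flux_eq (i : Fin 3) (u : V3) :
    ∫ w, ∑ j : Fin 3, Aent γ i j (u - w) * (f w * fderiv ℝ g u (e3 j) - g u * fderiv ℝ f w (e3 j))
      = ∑ j, (kconv (regA γ 0 i j) f u * sd j g u - kconv (regA γ 0 i j) (sd j f) u * g u) := by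
  have hA := isSingKernel_regA hγl hγu le_rfl zero_le_one
  have : ∀ᵐ w : V3, w ≠ u := Measure.ae_ne _ _
  have hc : ∀ᵐ w : V3, ∑ j : Fin 3, Aent γ i j (u - w) *
      (f w * fderiv ℝ g u (e3 j) - g u * fderiv ℝ f w (e3 j)) =
      ∑ j : Fin 3, (regA γ 0 i j (u - w) * f w * sd j g u -
        regA γ 0 i j (u - w) * sd j f w * g u) := by
    filter_upwards [this] with w hw
    refine Finset.sum_congr rfl fun j _ => ?_
    rw [Aent_eq_regA _ _ _ (sub_ne_zero.2 hw.symm), sd_apply, sd_apply]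
    ring
  have h1 : ∀ j, Integrable (fun w => regA γ 0 i j (u - w) * f w * sd j g u) :=
    fun j => ((hA i j).integrable_mul f u).mul_const _
  have h2 : ∀ j, Integrable (fun w => regA γ 0 i j (u - w) * sd j f w * g u) :=
    fun j => ((hA i j).integrable_mul (sd j f) u).mul_const _
  have h12 : ∀ j, Integrable (fun w => regA γ 0 i j (u - w) * f w * sd j g u -
      regA γ 0 i j (u - w) * sd j f w * g u) := fun j => (h1 j).sub (h2 j)
  rw [integral_congr_ae hc, integral_finsetSum _ fun j _ => h12 j]
  refine Finset.sum_congr rfl fun j _ => ?_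
  rw [integral_sub (h1 j) (h2 j), integral_mul_const, integral_mul_const]
  rfl

lemma landauQ_eq (v : V3) :
    LandauQ γ f g v = ∑ i, ∑ j,
      (kconv (regA γ 0 i j) (sd i f) v * sd j g v + kconv (regA γ 0 i j) f v * sd i (sd j g) v
        - kconv (regA γ 0 i j) (sd i (sd j f)) v * g v
        - kconv (regA γ 0 i j) (sd j f) v * sd i g v) := by
  have hA := isSingKernel_regA hγl hγu le_rfl zero_le_one
  unfold LandauQ
  refine Finset.sum_congr rfl fun i _ => ?_
  simp only [landau_flux_eq hγl hγu]
  choose L hL hLe using fun j => (hA i j).hasFDerivAt_kconv f v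
  choose L' hL' hLe' using fun j => (hA i j).hasFDerivAt_kconv (sd j f) v
  have hd := HasFDerivAt.fun_sum (u := Finset.univ) fun j _ =>
    ((hL j).fun_mul ((sd j g).hasFDerivAt v)).fun_sub ((hL' j).fun_mul (g.hasFDerivAt v))
  rw [hd.fderiv]
  simp only [sum_apply, sub_apply,
    add_apply, smul_apply, hLe, hLe', smul_eq_mul,
    ← sd_apply]
  exact Finset.sum_congr rfl fun j _ => by ring

lemma integral_landauQ_mul :
    ∫ v, LandauQ γ f g v * h v =
      ∑ i, ∑ j, (∫ v, kconv (regA γ 0 i j) f v * g v * sd j (sd i h) v)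
        + ∑ i, -4 * ∫ v, kconv (regB γ 0 i) f v * g v * sd i h v := by
  have hA := isSingKernel_regA hγl hγu le_rfl zero_le_one
  have hB := isSingKernel_regB hγl hγu le_rfl zero_le_one
  simp only [landauQ_eq hγl hγu, Finset.sum_mul, sub_mul, add_mul]
  have i1 := fun i j => (hA i j).integrable_kconv_mul_mul (sd i f) (sd j g) h
  have i2 := fun i j => (hA i j).integrable_kconv_mul_mul f (sd i (sd j g)) h
  have i3 := fun i j => (hA i j).integrable_kconv_mul_mul (sd i (sd j f)) g h
  have i4 := fun i j => (hA i j).integrable_kconv_mul_mul (sd j f) (sd i g) h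
  have i12 : ∀ i j, Integrable (fun v => kconv (regA γ 0 i j) (sd i f) v * sd j g v * h v
      + kconv (regA γ 0 i j) f v * sd i (sd j g) v * h v) := fun i j => (i1 i j).add (i2 i j)
  have i123 : ∀ i j, Integrable (fun v => kconv (regA γ 0 i j) (sd i f) v * sd j g v * h v
      + kconv (regA γ 0 i j) f v * sd i (sd j g) v * h v
      - kconv (regA γ 0 i j) (sd i (sd j f)) v * g v * h v) := fun i j => (i12 i j).sub (i3 i j)
  have i1234 : ∀ i j, Integrable (fun v => kconv (regA γ 0 i j) (sd i f) v * sd j g v * h v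
      + kconv (regA γ 0 i j) f v * sd i (sd j g) v * h v
      - kconv (regA γ 0 i j) (sd i (sd j f)) v * g v * h v
      - kconv (regA γ 0 i j) (sd j f) v * sd i g v * h v) := fun i j => (i123 i j).sub (i4 i j)
  rw [integral_finsetSum _ fun i _ => integrable_finsetSum _ fun j _ => i1234 i j,
    ← Finset.sum_add_distrib]
  refine Finset.sum_congr rfl fun i _ => ?_
  rw [integral_finsetSum _ fun j _ => i1234 i j]
  have hb : ∑ j, ∫ v, kconv (regA γ 0 i j) (sd j f) v * g v * sd i h v =
      -2 * ∫ v, kconv (regB γ 0 i) f v * g v * sd i h v := by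
    rw [← integral_finsetSum _ fun j _ => (hA i j).integrable_kconv_mul_mul (sd j f) g (sd i h),
      ← integral_const_mul]
    refine integral_congr_ae (.of_forall fun v => ?_)
    simp only [← Finset.sum_mul, sum_kconv_regA hγl hγu]
    ring
  have hstep : ∀ j, ∫ v, kconv (regA γ 0 i j) (sd i f) v * sd j g v * h v
      + kconv (regA γ 0 i j) f v * sd i (sd j g) v * h v
      - kconv (regA γ 0 i j) (sd i (sd j f)) v * g v * h v
      - kconv (regA γ 0 i j) (sd j f) v * sd i g v * h v =
      (∫ v, kconv (regA γ 0 i j) f v * g v * sd j (sd i h) v) +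
      2 * ∫ v, kconv (regA γ 0 i j) (sd j f) v * g v * sd i h v := by
    intro j
    rw [integral_sub (i123 i j) (i4 i j), integral_sub (i12 i j) (i3 i j),
      integral_add (i1 i j) (i2 i j)]
    have p1 := (hA i j).integral_product_rule f (sd j g) h i
    have p2 := (hA i j).integral_product_rule (sd j f) g h i
    have p3 := (hA i j).integral_product_rule f g (sd i h) j
    linarith
  rw [Finset.sum_congr rfl fun j _ => hstep j, Finset.sum_add_distrib, ← Finset.mul_sum, hb]
  ring

end weak

open scoped ENNReal

/-- The `L²` norm of an extended nonnegative function. -/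
noncomputable def en2 (F : V3 → ℝ≥0∞) : ℝ≥0∞ := (∫⁻ v, F v ^ 2) ^ (1 / 2 : ℝ)

lemma en2_sq (F : V3 → ℝ≥0∞) : en2 F ^ 2 = ∫⁻ v, F v ^ 2 := by
  rw [en2, ← ENNReal.rpow_natCast, ← ENNReal.rpow_mul]
  norm_num

lemma en2_mono {F G : V3 → ℝ≥0∞} (h : ∀ v, F v ≤ G v) : en2 F ≤ en2 G := by
  unfold en2
  gcongr
  exact h _

lemma lintegral_mul_le_en2 {F G : V3 → ℝ≥0∞} (hF : Measurable F) (hG : Measurable G) :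
    ∫⁻ v, F v * G v ≤ en2 F * en2 G := by
  simpa [en2] using ENNReal.lintegral_mul_le_Lp_mul_Lq volume Real.HolderConjugate.two_two
    hF.aemeasurable hG.aemeasurable

/-- The weight `⟨v⟩^s` with values in `ℝ≥0∞`. -/
noncomputable def japE (s : ℝ) (v : V3) : ℝ≥0∞ := ENNReal.ofReal (jap v ^ s)

lemma one_le_jap (v : V3) : 1 ≤ jap v := by
  rw [jap, Real.one_le_sqrt]
  nlinarith [sq_nonneg ‖v‖]

lemma jap_pos (v : V3) : 0 < jap v := zero_lt_one.trans_le (one_le_jap v)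

lemma japE_add (s t : ℝ) (v : V3) : japE (s + t) v = japE s v * japE t v := by
  rw [japE, Real.rpow_add (jap_pos v), ENNReal.ofReal_mul (Real.rpow_nonneg (jap_pos v).le _)]
  rfl

lemma japE_zero (v : V3) : japE 0 v = 1 := by simp [japE]

lemma japE_mono {s t : ℝ} (h : s ≤ t) (v : V3) : japE s v ≤ japE t v :=
  ENNReal.ofReal_le_ofReal (Real.rpow_le_rpow_of_exponent_le (one_le_jap v) h)

lemma measurable_japE (s : ℝ) : Measurable (japE s) := by
  unfold japE jap
  fun_prop

lemma measurable_japE_mul (s : ℝ) {F : V3 → ℝ} (hF : Measurable F) :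
    Measurable fun v => japE s v * ‖F v‖ₑ := (measurable_japE s).mul hF.enorm

lemma measurable_japE_mul_mul (s : ℝ) {F G : V3 → ℝ} (hF : Measurable F) (hG : Measurable G) :
    Measurable fun v => japE s v * (‖F v‖ₑ * ‖G v‖ₑ) :=
  (measurable_japE s).mul (hF.enorm.mul hG.enorm)

lemma en2_japE_neg_two_ne_top : en2 (japE (-2)) ≠ ∞ := by
  have h : Integrable (fun v : V3 => (1 + ‖v‖ ^ 2) ^ (-(4 : ℝ) / 2)) :=
    integrable_rpow_neg_one_add_norm_sq (by simp; norm_num)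
  refine ENNReal.rpow_ne_top_of_nonneg (by norm_num) (ne_top_of_le_ne_top h.2.ne ?_)
  refine lintegral_mono fun v => ?_
  rw [Real.enorm_eq_ofReal (by positivity), japE, ← ENNReal.ofReal_pow
    (Real.rpow_nonneg (jap_pos v).le _)]
  refine ENNReal.ofReal_le_ofReal ?_
  rw [jap, Real.sqrt_eq_rpow, ← Real.rpow_mul (by positivity), ← Real.rpow_natCast,
    ← Real.rpow_mul (by positivity)]
  have hv := sq_nonneg ‖v‖
  calc (2 + ‖v‖ ^ 2) ^ (1 / 2 * -2 * ((2 : ℕ) : ℝ)) = (2 + ‖v‖ ^ 2) ^ (-(4 : ℝ) / 2) := by norm_num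
    _ ≤ _ := Real.rpow_le_rpow_of_nonpos (by linarith) (by linarith) (by norm_num)

/-- The weighted norm `‖⟨v⟩^s F‖_{L²}` with values in `ℝ≥0∞`. -/
noncomputable def wE (s : ℝ) (F : V3 → ℝ) : ℝ≥0∞ := en2 fun v => japE s v * ‖F v‖ₑ

lemma wE_mono {s t : ℝ} (h : s ≤ t) (F : V3 → ℝ) : wE s F ≤ wE t F :=
  en2_mono fun v => by gcongr; exact japE_mono h v

lemma lintegral_le_wE {f : V3 → ℝ} (hf : Measurable f) (s : ℝ) :
    ∫⁻ w, japE s w * ‖f w‖ₑ ≤ en2 (japE (-2)) * wE (s + 2) f := by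
  refine le_trans (le_of_eq (lintegral_congr fun w => ?_)) (lintegral_mul_le_en2
    (measurable_japE _) (measurable_japE_mul (s + 2) hf))
  rw [← mul_assoc, ← japE_add]
  ring_nf

lemma lintegral_mul_le_wE {g φ : V3 → ℝ} (hg : Measurable g) (hφ : Measurable φ) (s ℓ : ℝ) :
    ∫⁻ v, japE s v * (‖g v‖ₑ * ‖φ v‖ₑ) ≤ wE (s - ℓ) g * wE ℓ φ := by
  refine le_trans (le_of_eq (lintegral_congr fun v => ?_)) (lintegral_mul_le_en2
    (measurable_japE_mul (s - ℓ) hg) (measurable_japE_mul ℓ hφ))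
  rw [mul_mul_mul_comm, ← japE_add]
  ring_nf

section forms

variable {f g φ : V3 → ℝ} (ℓ : ℝ)

lemma lintegral_far_le (hf : Measurable f) (hg : Measurable g) (hφ : Measurable φ) :
    ∫⁻ v, (∫⁻ w, japE 3 v * japE 3 w * ‖f w‖ₑ) * (‖g v‖ₑ * ‖φ v‖ₑ) ≤
      en2 (japE (-2)) * (wE 5 f * wE (5 - ℓ) g * wE ℓ φ) := by
  have h1 : ∀ v, (∫⁻ w, japE 3 v * japE 3 w * ‖f w‖ₑ) * (‖g v‖ₑ * ‖φ v‖ₑ) =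
      (∫⁻ w, japE 3 w * ‖f w‖ₑ) * (japE 3 v * (‖g v‖ₑ * ‖φ v‖ₑ)) := fun v => by
    simp only [mul_assoc]
    rw [lintegral_const_mul _ (measurable_japE_mul 3 hf)]
    ring
  simp only [h1]
  rw [lintegral_const_mul _ (measurable_japE_mul_mul 3 hg hφ)]
  calc _ ≤ (en2 (japE (-2)) * wE (3 + 2) f) * (wE (3 - ℓ) g * wE ℓ φ) := by
        gcongr
        exacts [lintegral_le_wE hf 3, lintegral_mul_le_wE hg hφ 3 ℓ]
    _ ≤ (en2 (japE (-2)) * wE 5 f) * (wE (5 - ℓ) g * wE ℓ φ) := by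
        norm_num
        gcongr
        exact wE_mono (by linarith) g
    _ = _ := by ring

lemma lintegral_sq_kernel_le {k : V3 → ℝ≥0∞} (hk : Measurable k) (hf : Measurable f)
    (hg : Measurable g) (hφ : Measurable φ) :
    ∫⁻ v, (∫⁻ w, k (v - w) * ‖f w‖ₑ) * (‖g v‖ₑ * ‖φ v‖ₑ) ≤
      en2 k * (wE 5 f * wE (5 - ℓ) g * wE ℓ φ) := by
  have h1 : ∀ v, ∫⁻ w, k (v - w) * ‖f w‖ₑ ≤ en2 k * wE 5 f := fun v => by
    refine (lintegral_mul_le_en2 (hk.comp (measurable_const.sub measurable_id))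
      hf.enorm).trans ?_
    gcongr
    · refine le_of_eq ?_
      unfold en2
      congr 1
      exact lintegral_sub_left_eq_self (fun u => k u ^ 2) v
    · refine (en2_mono fun w => ?_).trans (wE_mono (s := 0) (by norm_num) f)
      simp [japE_zero]
  calc _ ≤ ∫⁻ v, (en2 k * wE 5 f) * (japE 0 v * (‖g v‖ₑ * ‖φ v‖ₑ)) := by
        refine lintegral_mono fun v => ?_
        rw [japE_zero, one_mul]
        gcongr
        exact h1 v
    _ = (en2 k * wE 5 f) * ∫⁻ v, japE 0 v * (‖g v‖ₑ * ‖φ v‖ₑ) :=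
        lintegral_const_mul _ (measurable_japE_mul_mul 0 hg hφ)
    _ ≤ (en2 k * wE 5 f) * (wE (5 - ℓ) g * wE ℓ φ) := by
        gcongr
        refine (lintegral_mul_le_wE hg hφ 0 ℓ).trans ?_
        gcongr
        exact wE_mono (by linarith) g
    _ = _ := by ring

lemma lintegral_hardy_kernel_le {k : V3 → ℝ≥0∞} (hk : Measurable k) {H : ℝ≥0∞}
    (hH : ∀ w, ∫⁻ v, k (v - w) * (japE ℓ v * ‖φ v‖ₑ) ^ 2 ≤ H ^ 2)
    (hf : Measurable f) (hg : Measurable g) (hφ : Measurable φ) :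
    ∫⁻ v, (∫⁻ w, k (v - w) * ‖f w‖ₑ) * (‖g v‖ₑ * ‖φ v‖ₑ) ≤
      (∫⁻ u, k u) ^ (1 / 2 : ℝ) * (wE 5 f * wE (5 - ℓ) g * H) := by
  set G : V3 → ℝ≥0∞ := fun v => ∫⁻ w, k (v - w) * ‖f w‖ₑ with hG
  have hkm : Measurable fun p : V3 × V3 => k (p.1 - p.2) := hk.comp (by fun_prop)
  have hGm : Measurable G := Measurable.lintegral_prod_right'
    (f := fun p : V3 × V3 => k (p.1 - p.2) * ‖f p.2‖ₑ)
    (hkm.mul (hf.comp measurable_snd).enorm)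
  have hsq : ∀ x : ℝ≥0∞, (x ^ (1 / 2 : ℝ)) ^ 2 = x := fun x => by
    rw [← ENNReal.rpow_natCast, ← ENNReal.rpow_mul]; norm_num
  have hGsq : ∀ v, G v ^ 2 ≤ (∫⁻ u, k u) * ∫⁻ w, k (v - w) * ‖f w‖ₑ ^ 2 := fun v => by
    have hkv : Measurable fun w => k (v - w) := hk.comp (measurable_const.sub measurable_id)
    have h := lintegral_mul_le_en2 (hkv.pow_const (1 / 2 : ℝ))
      ((hkv.pow_const (1 / 2 : ℝ)).mul hf.enorm)
    calc G v ^ 2 = (∫⁻ w, k (v - w) ^ (1 / 2 : ℝ) *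
          ((fun w => k (v - w) ^ (1 / 2 : ℝ)) * fun w => ‖f w‖ₑ) w) ^ 2 := by
          rw [hG]
          congr 1
          refine lintegral_congr fun w => ?_
          rw [Pi.mul_apply, ← mul_assoc, ← sq, hsq]
      _ ≤ (en2 (fun w => k (v - w) ^ (1 / 2 : ℝ)) *
          en2 ((fun w => k (v - w) ^ (1 / 2 : ℝ)) * fun w => ‖f w‖ₑ)) ^ 2 := by gcongr
      _ = _ := by
          rw [mul_pow, en2_sq, en2_sq]
          simp only [Pi.mul_apply, mul_pow, hsq]
          rw [lintegral_sub_left_eq_self (fun u => k u) v]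
  have hmain : en2 (fun v => G v * (japE ℓ v * ‖φ v‖ₑ)) ≤
      (∫⁻ u, k u) ^ (1 / 2 : ℝ) * (H * wE 5 f) := by
    have hm2 : Measurable fun p : V3 × V3 =>
        k (p.1 - p.2) * (japE ℓ p.1 * ‖φ p.1‖ₑ) ^ 2 * ‖f p.2‖ₑ ^ 2 :=
      (hkm.mul (((measurable_japE_mul ℓ hφ).comp measurable_fst).pow_const 2)).mul
        ((hf.comp measurable_snd).enorm.pow_const 2)
    rw [← ENNReal.pow_le_pow_left_iff two_ne_zero, en2_sq, mul_pow, hsq, mul_pow]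
    calc ∫⁻ v, (G v * (japE ℓ v * ‖φ v‖ₑ)) ^ 2
        ≤ ∫⁻ v, (∫⁻ u, k u) * ∫⁻ w,
            k (v - w) * (japE ℓ v * ‖φ v‖ₑ) ^ 2 * ‖f w‖ₑ ^ 2 := by
          refine lintegral_mono fun v => ?_
          have : ∫⁻ w, k (v - w) * (japE ℓ v * ‖φ v‖ₑ) ^ 2 * ‖f w‖ₑ ^ 2 =
              (∫⁻ w, k (v - w) * ‖f w‖ₑ ^ 2) * (japE ℓ v * ‖φ v‖ₑ) ^ 2 := by
            rw [← lintegral_mul_const]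
            · exact lintegral_congr fun w => by ring
            · exact (hk.comp (measurable_const.sub measurable_id)).mul (hf.enorm.pow_const 2)
          rw [this, mul_pow, ← mul_assoc]
          gcongr
          exact hGsq v
      _ = (∫⁻ u, k u) * ∫⁻ v, ∫⁻ w,
            k (v - w) * (japE ℓ v * ‖φ v‖ₑ) ^ 2 * ‖f w‖ₑ ^ 2 :=
          lintegral_const_mul _ hm2.lintegral_prod_right'
      _ = (∫⁻ u, k u) * ∫⁻ w, ∫⁻ v,
            k (v - w) * (japE ℓ v * ‖φ v‖ₑ) ^ 2 * ‖f w‖ₑ ^ 2 := by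
          rw [lintegral_lintegral_swap hm2.aemeasurable]
      _ ≤ (∫⁻ u, k u) * ∫⁻ w, H ^ 2 * (japE 5 w * ‖f w‖ₑ) ^ 2 := by
          gcongr with w
          rw [lintegral_mul_const]
          · gcongr
            · exact hH w
            · calc ‖f w‖ₑ = japE 0 w * ‖f w‖ₑ := by rw [japE_zero, one_mul]
                _ ≤ _ := by gcongr; exact japE_mono (by norm_num) w
          · exact (hk.comp (measurable_id.sub measurable_const)).mul
              ((measurable_japE_mul ℓ hφ).pow_const 2)
      _ = _ := by
          rw [lintegral_const_mul _ ((measurable_japE_mul 5 hf).pow_const 2), wE, en2_sq]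
  calc _ = ∫⁻ v, (japE (-ℓ) v * ‖g v‖ₑ) * (G v * (japE ℓ v * ‖φ v‖ₑ)) := by
        refine lintegral_congr fun v => ?_
        calc _ = japE (-ℓ + ℓ) v * (G v * (‖g v‖ₑ * ‖φ v‖ₑ)) := by
              rw [neg_add_cancel, japE_zero, one_mul]
          _ = _ := by rw [japE_add]; ring
    _ ≤ wE (-ℓ) g * en2 (fun v => G v * (japE ℓ v * ‖φ v‖ₑ)) :=
        lintegral_mul_le_en2 (measurable_japE_mul _ hg)
          (hGm.mul (measurable_japE_mul ℓ hφ))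
    _ ≤ wE (5 - ℓ) g * ((∫⁻ u, k u) ^ (1 / 2 : ℝ) * (H * wE 5 f)) := by
        gcongr
        exact wE_mono (by linarith) g
    _ = _ := by ring

end forms

lemma hasFDerivAt_inv_mul_coord {ε : ℝ} (hε : 0 < ε) (a v : V3) (j : Fin 3) :
    ∃ L : V3 →L[ℝ] ℝ,
      HasFDerivAt (fun v : V3 => (ε + ‖a - v‖ ^ 2) ^ (-1 : ℝ) * (a - v) j) L v ∧
      L (e3 j) = 2 * (a - v) j ^ 2 / (ε + ‖a - v‖ ^ 2) ^ 2 - 1 / (ε + ‖a - v‖ ^ 2) := by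
  have hs : HasFDerivAt (fun v : V3 => a - v) (-ContinuousLinearMap.id ℝ V3) v :=
    (hasFDerivAt_id v).const_sub a
  have hc : HasFDerivAt (fun v : V3 => (a - v) j)
      ((EuclideanSpace.proj j : V3 →L[ℝ] ℝ).comp (-ContinuousLinearMap.id ℝ V3)) v :=
    ((EuclideanSpace.proj j : V3 →L[ℝ] ℝ).hasFDerivAt).comp v hs
  have hpos : 0 < ε + ‖a - v‖ ^ 2 := by positivity
  have h := ((hs.norm_sq.const_add ε).rpow_const (p := -1) (Or.inl hpos.ne')).mul hc
  refine ⟨_, h, ?_⟩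
  simp only [show (-1 : ℝ) - 1 = -((2 : ℕ) : ℝ) by norm_num,
    Real.rpow_neg hpos.le, Real.rpow_natCast]
  simp [e3, EuclideanSpace.inner_single_right]
  field_simp
  ring

lemma SchwartzMap.integrable_sq (s : 𝓢(V3, ℝ)) : Integrable (fun v => s v ^ 2) := by
  have h := (schwartzMul s s).integrable (μ := volume)
  refine h.congr (.of_forall fun v => ?_)
  simp [schwartzMul_apply, sq]

lemma integral_sq_div_le {ε : ℝ} (hε : 0 < ε) (a : V3) (ψ : 𝓢(V3, ℝ)) :
    Integrable (fun v => ψ v ^ 2 / (ε + ‖a - v‖ ^ 2)) ∧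
    ∫ v, ψ v ^ 2 / (ε + ‖a - v‖ ^ 2) ≤ 4 * ∫ v, ∑ j, sd j ψ v ^ 2 := by
  let V : Fin 3 → V3 → ℝ := fun j v => (ε + ‖a - v‖ ^ 2) ^ (-1 : ℝ) * (a - v) j
  have hT : ∀ j, Function.HasTemperateGrowth (V j) := fun j =>
    ((hasTemperateGrowth_add_norm_sq_rpow hε (-1)).comp (hasTemperateGrowth_const_sub a)).mul
      (hasTemperateGrowth_coord_sub a j)
  let S : Fin 3 → 𝓢(V3, ℝ) := fun j => SchwartzMap.smulLeftCLM ℝ (V j) (schwartzMul ψ ψ)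
  have hS : ∀ j, (S j : V3 → ℝ) = fun v => V j v * (ψ v * ψ v) := fun j => by
    ext v; simp [S, SchwartzMap.smulLeftCLM_apply_apply (hT j), schwartzMul_apply]
  have hpt : ∀ v, ψ v ^ 2 / (ε + ‖a - v‖ ^ 2) ≤
      4 * ∑ j, sd j ψ v ^ 2 - 2 * ∑ j, fderiv ℝ (S j) v (e3 j) := by
    intro v
    choose L hL hLe using hasFDerivAt_inv_mul_coord hε a v
    have hd : ∀ j, fderiv ℝ (S j) v (e3 j) =
        V j v * (2 * ψ v * sd j ψ v) + ψ v ^ 2 * L j (e3 j) := fun j => by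
      have := (hL j).fun_mul ((ψ.hasFDerivAt v).fun_mul (ψ.hasFDerivAt v))
      rw [hS]
      simp only [V]
      rw [this.fderiv]
      simp [sd_apply]
      ring
    have hn : ‖a - v‖ ^ 2 = (a - v) 0 ^ 2 + (a - v) 1 ^ 2 + (a - v) 2 ^ 2 := by
      rw [EuclideanSpace.real_norm_sq_eq, Fin.sum_univ_three]
    have hpos : 0 < ε + ‖a - v‖ ^ 2 := by positivity
    simp only [hd, hLe, V, Real.rpow_neg_one, Fin.sum_univ_three]
    set D := ε + ‖a - v‖ ^ 2
    have hD : (a - v) 0 ^ 2 + (a - v) 1 ^ 2 + (a - v) 2 ^ 2 = D - ε := by rw [← hn]; simp [D]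
    set x := (a - v) 0
    set y := (a - v) 1
    set z := (a - v) 2
    set p := ψ v
    have key : 0 ≤ (2 * sd 0 ψ v - D⁻¹ * x * p) ^ 2 + (2 * sd 1 ψ v - D⁻¹ * y * p) ^ 2 +
      (2 * sd 2 ψ v - D⁻¹ * z * p) ^ 2 := by positivity
    have hi : D⁻¹ * D = 1 := inv_mul_cancel₀ hpos.ne'
    have h5 : 0 ≤ 5 * p ^ 2 * ε * D⁻¹ ^ 2 := by positivity
    simp only [div_eq_mul_inv, ← inv_pow, one_mul]
    linear_combination key + h5 + 5 * p ^ 2 * D⁻¹ ^ 2 * hD + 5 * p ^ 2 * D⁻¹ * hi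
  have hI : Integrable (fun v => ψ v ^ 2 / (ε + ‖a - v‖ ^ 2)) := by
    refine (ψ.integrable_sq.const_mul ε⁻¹).mono' ?_ (.of_forall fun v => ?_)
    · have := ψ.continuous
      exact Measurable.aestronglyMeasurable (by fun_prop)
    · rw [Real.norm_of_nonneg (by positivity), div_eq_inv_mul]
      gcongr
      linarith [sq_nonneg ‖a - v‖]
  have hI1 : Integrable (fun v => ∑ j, sd j ψ v ^ 2) :=
    integrable_finsetSum _ fun j _ => (sd j ψ).integrable_sq
  have hSi : ∀ j, Integrable (fun v => fderiv ℝ (S j) v (e3 j)) := fun j => by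
    simpa only [← sd_apply] using (sd j (S j)).integrable
  have hI2 : Integrable (fun v => ∑ j, fderiv ℝ (S j) v (e3 j)) :=
    integrable_finsetSum _ fun j _ => hSi j
  refine ⟨hI, (integral_mono hI ((hI1.const_mul 4).sub (hI2.const_mul 2)) hpt).trans_eq ?_⟩
  simp only [Pi.sub_apply]
  rw [integral_sub (hI1.const_mul 4) (hI2.const_mul 2), integral_const_mul, integral_const_mul,
    integral_finsetSum _ fun j _ => hSi j]
  simp [SchwartzMap.integral_fderiv_eq_zero]

/-- Hardy's inequality in `ℝ³`. -/
lemma lintegral_hardy_le (w : V3) (ψ : 𝓢(V3, ℝ)) :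
    ∫⁻ v, ENNReal.ofReal (‖v - w‖ ^ 2)⁻¹ * ‖ψ v‖ₑ ^ 2 ≤
      ENNReal.ofReal (4 * ∫ v, ∑ j, sd j ψ v ^ 2) := by
  have hm : ∀ n : ℕ, Measurable fun v : V3 =>
      ENNReal.ofReal (ψ v ^ 2 / (1 / ((n : ℝ) + 1) + ‖w - v‖ ^ 2)) := fun n => by
    have := ψ.continuous
    fun_prop
  have hlim : ∀ᵐ v : V3, ENNReal.ofReal (‖v - w‖ ^ 2)⁻¹ * ‖ψ v‖ₑ ^ 2 =
      Filter.liminf (fun n : ℕ => ENNReal.ofReal (ψ v ^ 2 / (1 / ((n : ℝ) + 1) + ‖w - v‖ ^ 2)))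
        Filter.atTop := by
    have : ∀ᵐ v : V3, v ≠ w := Measure.ae_ne _ _
    filter_upwards [this] with v hv
    have hr : 0 < ‖w - v‖ := norm_pos_iff.2 (sub_ne_zero.2 hv.symm)
    have h := (tendsto_one_div_add_atTop_nhds_zero_nat (𝕜 := ℝ)).add_const (‖w - v‖ ^ 2)
    have h' := ENNReal.tendsto_ofReal ((tendsto_const_nhds (x := ψ v ^ 2)).div h (by positivity))
    simp only [Pi.div_apply] at h'
    rw [h'.liminf_eq, Real.enorm_eq_ofReal_abs,
      ← ENNReal.ofReal_pow (abs_nonneg _), sq_abs, ← ENNReal.ofReal_mul (by positivity),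
      norm_sub_rev v w, zero_add, div_eq_inv_mul]
  rw [lintegral_congr_ae hlim]
  refine (lintegral_liminf_le hm).trans (Filter.liminf_le_of_le (by isBoundedDefault) ?_)
  intro b hb
  obtain ⟨n, hn⟩ := hb.exists
  have hε : (0 : ℝ) < 1 / ((n : ℝ) + 1) := by positivity
  obtain ⟨h1, h2⟩ := integral_sq_div_le hε w ψ
  refine hn.trans ?_
  rw [← ofReal_integral_eq_lintegral_ofReal h1 (.of_forall fun v => by positivity)]
  exact ENNReal.ofReal_le_ofReal h2

lemma jap_rpow_eq (ℓ : ℝ) (v : V3) : jap v ^ ℓ = (2 + ‖v‖ ^ 2) ^ (ℓ / 2) := by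
  rw [jap, Real.sqrt_eq_rpow, ← Real.rpow_mul (by positivity)]
  ring_nf

lemma jap_rpow_two_mul (ℓ : ℝ) (v : V3) : jap v ^ (2 * ℓ) = (jap v ^ ℓ) ^ 2 := by
  rw [mul_comm, Real.rpow_mul (jap_pos v).le, Real.rpow_two]

lemma hasTemperateGrowth_jap_rpow (ℓ : ℝ) : Function.HasTemperateGrowth fun v => jap v ^ ℓ := by
  simpa only [jap_rpow_eq] using hasTemperateGrowth_add_norm_sq_rpow two_pos (ℓ / 2)

/-- The Schwartz function `⟨v⟩^ℓ F`. -/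
noncomputable def japMul (ℓ : ℝ) (F : 𝓢(V3, ℝ)) : 𝓢(V3, ℝ) :=
  SchwartzMap.smulLeftCLM ℝ (fun v => jap v ^ ℓ) F

lemma japMul_apply (ℓ : ℝ) (F : 𝓢(V3, ℝ)) (v : V3) : japMul ℓ F v = jap v ^ ℓ * F v := by
  simp [japMul, SchwartzMap.smulLeftCLM_apply_apply (hasTemperateGrowth_jap_rpow ℓ)]

lemma enorm_japMul (ℓ : ℝ) (F : 𝓢(V3, ℝ)) (v : V3) : ‖japMul ℓ F v‖ₑ = japE ℓ v * ‖F v‖ₑ := by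
  rw [japMul_apply, enorm_mul, Real.enorm_eq_ofReal (Real.rpow_nonneg (jap_pos v).le _), japE]

lemma integrable_jap_mul_sq (ℓ : ℝ) (F : 𝓢(V3, ℝ)) :
    Integrable fun v => jap v ^ (2 * ℓ) * F v ^ 2 := by
  simpa only [jap_rpow_two_mul, ← mul_pow, ← japMul_apply] using (japMul ℓ F).integrable_sq

lemma wE_eq_ofReal_wL2 (ℓ : ℝ) (F : 𝓢(V3, ℝ)) : wE ℓ F = ENNReal.ofReal (wL2 ℓ F) := by
  have h0 : ∀ v, 0 ≤ jap v ^ (2 * ℓ) * F v ^ 2 := fun v =>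
    mul_nonneg (Real.rpow_nonneg (jap_pos v).le _) (sq_nonneg _)
  have h : ∫⁻ v, (japE ℓ v * ‖F v‖ₑ) ^ 2 = ENNReal.ofReal (∫ v, jap v ^ (2 * ℓ) * F v ^ 2) := by
    rw [ofReal_integral_eq_lintegral_ofReal (integrable_jap_mul_sq ℓ F) (.of_forall h0)]
    refine lintegral_congr fun v => ?_
    rw [← enorm_japMul, Real.enorm_eq_ofReal_abs, ← ENNReal.ofReal_pow (abs_nonneg _), sq_abs,
      japMul_apply, mul_pow, jap_rpow_two_mul]
  rw [wE, en2, h, wL2, Real.sqrt_eq_rpow, ENNReal.ofReal_rpow_of_nonneg (integral_nonneg h0)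
    (by norm_num)]

lemma sq_sd_japMul_le (ℓ : ℝ) (F : 𝓢(V3, ℝ)) (j : Fin 3) (v : V3) :
    sd j (japMul ℓ F) v ^ 2 ≤
      2 * (jap v ^ (2 * ℓ) * sd j F v ^ 2) + 2 * ℓ ^ 2 * (jap v ^ (2 * ℓ) * F v ^ 2) := by
  have hpos : 0 < 2 + ‖v‖ ^ 2 := by positivity
  have hn := ((hasFDerivAt_id v).norm_sq.const_add 2).rpow_const (p := ℓ / 2) (Or.inl hpos.ne')
  have h := hn.fun_mul (F.hasFDerivAt v)
  have hF : (japMul ℓ F : V3 → ℝ) = fun v => (2 + ‖id v‖ ^ 2) ^ (ℓ / 2) * F v := by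
    ext v
    rw [japMul_apply, jap_rpow_eq, id]
  have hd : sd j (japMul ℓ F) v =
      jap v ^ ℓ * sd j F v + ℓ * (v j / (2 + ‖v‖ ^ 2)) * (jap v ^ ℓ * F v) := by
    rw [sd_apply, hF, h.fderiv, jap_rpow_eq, sd_apply]
    simp [e3, EuclideanSpace.inner_single_right, Real.rpow_sub hpos]
    field_simp
  have hv : (v j / (2 + ‖v‖ ^ 2)) ^ 2 ≤ 1 := by
    rw [sq_le_one_iff_abs_le_one, abs_div, abs_of_pos hpos, div_le_one hpos]
    nlinarith [abs_coord_le v j, sq_nonneg (‖v‖ - 1)]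
  rw [hd, jap_rpow_two_mul]
  set a := jap v ^ ℓ * sd j F v
  set b := jap v ^ ℓ * F v
  set r := v j / (2 + ‖v‖ ^ 2)
  have h1 : ℓ ^ 2 * b ^ 2 * r ^ 2 ≤ ℓ ^ 2 * b ^ 2 * 1 := by gcongr
  rw [← mul_pow, ← mul_pow]
  nlinarith [sq_nonneg (a - ℓ * r * b)]

lemma lintegral_hardy_weighted_le (ℓ : ℝ) (φ : 𝓢(V3, ℝ)) {H : ℝ}
    (h0 : wL2 ℓ φ ^ 2 ≤ H) (h1 : ∀ j, wL2 ℓ (sd j φ) ^ 2 ≤ H) (w : V3) :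
    ∫⁻ v, ENNReal.ofReal (‖v - w‖ ^ 2)⁻¹ * (japE ℓ v * ‖φ v‖ₑ) ^ 2 ≤
      ENNReal.ofReal (24 * (1 + ℓ ^ 2) * H) := by
  have hsq : ∀ F : 𝓢(V3, ℝ), wL2 ℓ F ^ 2 = ∫ v, jap v ^ (2 * ℓ) * F v ^ 2 := fun F =>
    Real.sq_sqrt (integral_nonneg fun v =>
      mul_nonneg (Real.rpow_nonneg (jap_pos v).le _) (sq_nonneg _))
  have h := lintegral_hardy_le w (japMul ℓ φ)
  simp only [enorm_japMul] at h
  refine h.trans (ENNReal.ofReal_le_ofReal ?_)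
  have hj : ∀ j, ∫ v, sd j (japMul ℓ φ) v ^ 2 ≤ 2 * H + 2 * ℓ ^ 2 * H := fun j => by
    have i1 := (integrable_jap_mul_sq ℓ (sd j φ)).const_mul 2
    have i2 := (integrable_jap_mul_sq ℓ φ).const_mul (2 * ℓ ^ 2)
    calc ∫ v, sd j (japMul ℓ φ) v ^ 2
        ≤ ∫ v, (2 * (jap v ^ (2 * ℓ) * sd j φ v ^ 2)
            + 2 * ℓ ^ 2 * (jap v ^ (2 * ℓ) * φ v ^ 2)) :=
          integral_mono (sd j (japMul ℓ φ)).integrable_sq (i1.add i2) (sq_sd_japMul_le ℓ φ j)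
      _ = 2 * wL2 ℓ (sd j φ) ^ 2 + 2 * ℓ ^ 2 * wL2 ℓ φ ^ 2 := by
          rw [integral_add i1 i2, integral_const_mul, integral_const_mul, hsq, hsq]
      _ ≤ _ := by
          gcongr
          exact h1 j
  rw [integral_finsetSum _ fun j _ => (sd j (japMul ℓ φ)).integrable_sq, Fin.sum_univ_three]
  linarith [hj 0, hj 1, hj 2]

lemma pd_coe (i : Fin 3) (h : 𝓢(V3, ℝ)) : pd i h = sd i h := by
  ext v
  rw [pd, sd_apply]

lemma sd_comm (i j : Fin 3) (h : 𝓢(V3, ℝ)) : sd i (sd j h) = sd j (sd i h) := by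
  have hd : ∀ k l v, sd k (sd l h) v = fderiv ℝ (fderiv ℝ h) v (e3 k) (e3 l) := fun k l v => by
    have h2 : DifferentiableAt ℝ (fderiv ℝ h) v :=
      ((h.smooth 2).fderiv_right (m := 1) le_rfl).differentiable one_ne_zero v
    have hl : (sd l h : V3 → ℝ) = fun x => fderiv ℝ h x (e3 l) := funext fun x => sd_apply ..
    rw [sd_apply, hl, fderiv_clm_apply h2 (by fun_prop)]
    simp
  ext v
  rw [hd, hd]
  exact (h.smooth 2).contDiffAt.isSymmSndFDerivAt (by simp) _ _

lemma exists_mderiv_eq_sd (i : Fin 3) (h : 𝓢(V3, ℝ)) : ∃ β ∈ msetLe2, mderiv β h = sd i h := by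
  refine ⟨Pi.single i 1, ?_, ?_⟩
  · fin_cases i <;> simp [msetLe2] <;> decide
  · fin_cases i <;> simp [mderiv, pd_coe]

lemma exists_mderiv_eq_sd_sd (i j : Fin 3) (h : 𝓢(V3, ℝ)) :
    ∃ β ∈ msetLe2, mderiv β h = sd j (sd i h) := by
  refine ⟨Pi.single i 1 + Pi.single j 1, ?_, ?_⟩
  · fin_cases i <;> fin_cases j <;> simp [msetLe2] <;> decide
  · fin_cases i <;> fin_cases j <;> simp [mderiv, pd_coe]
    all_goals exact sd_comm ..

lemma sq_wL2_le_H2Sq (ℓ : ℝ) {F h : V3 → ℝ} (hF : ∃ β ∈ msetLe2, mderiv β h = F) :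
    wL2 ℓ F ^ 2 ≤ H2Sq ℓ h := by
  obtain ⟨β, hβ, rfl⟩ := hF
  have h0 : ∀ β, 0 ≤ ∫ v, jap v ^ (2 * ℓ) * mderiv β h v ^ 2 := fun β =>
    integral_nonneg fun v => mul_nonneg (Real.rpow_nonneg (jap_pos v).le _) (sq_nonneg _)
  rw [wL2, Real.sq_sqrt (h0 β), H2Sq]
  exact Finset.single_le_sum (f := fun β => ∫ v, jap v ^ (2 * ℓ) * mderiv β h v ^ 2)
    (fun β _ => h0 β) hβ

/-- A square-integrable kernel on `ℝ³` with the singularity `|z|⁻¹`. -/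
noncomputable def sqrtSingKer (z : V3) : ℝ := ‖z‖⁻¹ * ((1 + ‖z‖) ^ 2)⁻¹

lemma measurable_sqrtSingKer : Measurable sqrtSingKer := by unfold sqrtSingKer; fun_prop

lemma lintegral_singKer_ne_top : ∫⁻ u, ENNReal.ofReal (singKer u) ≠ ∞ := by
  rw [← ofReal_integral_eq_lintegral_ofReal integrable_singKer (.of_forall singKer_nonneg)]
  exact ENNReal.ofReal_ne_top

lemma en2_sqrtSingKer_ne_top : en2 (fun u => ENNReal.ofReal (sqrtSingKer u)) ≠ ∞ := by
  refine ENNReal.rpow_ne_top_of_nonneg (by norm_num) ?_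
  convert lintegral_singKer_ne_top using 3 with u
  rw [← ENNReal.ofReal_pow (by unfold sqrtSingKer; positivity), sqrtSingKer, singKer, mul_pow,
    inv_pow, inv_pow, ← pow_mul]

lemma norm_sub_le_jap_mul_jap (v w : V3) : ‖v - w‖ ≤ jap v * jap w := by
  rw [jap, jap, ← Real.sqrt_mul (by positivity)]
  refine Real.le_sqrt_of_sq_le ?_
  have h := norm_sub_le v w
  nlinarith [norm_nonneg (v - w), sq_nonneg (‖v‖ - ‖w‖), sq_nonneg (‖v‖ * ‖w‖)]

lemma enorm_kernel_le {A k : V3 → ℝ} (hk : ∀ u, 0 ≤ k u)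
    (h : ∀ u, |A u| ≤ 16 * k u + 8 * (1 + ‖u‖ ^ 3)) (v w : V3) :
    ‖A (v - w)‖ₑ ≤ 16 * (ENNReal.ofReal (k (v - w)) + japE 3 v * japE 3 w) := by
  have h3 : ∀ v, jap v ^ (3 : ℝ) = jap v ^ 3 := fun v => by exact_mod_cast Real.rpow_natCast _ 3
  have hv := one_le_jap v
  have hw := one_le_jap w
  have h1 : 1 ≤ (jap v * jap w) ^ 3 := one_le_pow₀ (one_le_mul_of_one_le_of_one_le hv hw)
  have h2 : ‖v - w‖ ^ 3 ≤ (jap v * jap w) ^ 3 := by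
    gcongr
    exact norm_sub_le_jap_mul_jap v w
  rw [japE, japE, h3, h3, ← ENNReal.ofReal_mul (by positivity), ← mul_pow,
    ← ENNReal.ofReal_add (hk _) (by positivity), Real.enorm_eq_ofReal_abs,
    show (16 : ℝ≥0∞) = ENNReal.ofReal 16 by norm_num, ← ENNReal.ofReal_mul (by norm_num)]
  exact ENNReal.ofReal_le_ofReal (by linarith [h (v - w)])

lemma enorm_integral_kconv_mul_mul_le {A : V3 → ℝ} {K : V3 → ℝ≥0∞} {c : ℝ≥0∞} (hK : Measurable K)
    (hA : ∀ v w, ‖A (v - w)‖ₑ ≤ c * (K (v - w) + japE 3 v * japE 3 w)) (ℓ : ℝ)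
    {f g φ : V3 → ℝ} (hf : Measurable f) (hg : Measurable g) (hφ : Measurable φ) {P : ℝ≥0∞}
    (hP : ∫⁻ v, (∫⁻ w, K (v - w) * ‖f w‖ₑ) * (‖g v‖ₑ * ‖φ v‖ₑ) ≤ P) :
    ‖∫ v, kconv A f v * g v * φ v‖ₑ ≤
      c * (P + en2 (japE (-2)) * (wE 5 f * wE (5 - ℓ) g * wE ℓ φ)) := by
  have hKm : Measurable fun p : V3 × V3 => K (p.1 - p.2) * ‖f p.2‖ₑ :=
    (hK.comp (by fun_prop)).mul (hf.comp measurable_snd).enorm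
  have hFm : Measurable fun p : V3 × V3 => japE 3 p.1 * japE 3 p.2 * ‖f p.2‖ₑ :=
    (((measurable_japE 3).comp measurable_fst).mul ((measurable_japE 3).comp measurable_snd)).mul
      (hf.comp measurable_snd).enorm
  have hgφ : Measurable fun v => ‖g v‖ₑ * ‖φ v‖ₑ := hg.enorm.mul hφ.enorm
  have hk : ∀ v, ‖kconv A f v‖ₑ ≤ c * ((∫⁻ w, K (v - w) * ‖f w‖ₑ) +
      ∫⁻ w, japE 3 v * japE 3 w * ‖f w‖ₑ) := fun v => by
    have m1 : Measurable fun w => K (v - w) * ‖f w‖ₑ :=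
      (hK.comp (measurable_const.sub measurable_id)).mul hf.enorm
    have m2 : Measurable fun w => japE 3 v * japE 3 w * ‖f w‖ₑ :=
      (measurable_const.mul (measurable_japE 3)).mul hf.enorm
    have m12 : Measurable fun w => K (v - w) * ‖f w‖ₑ + japE 3 v * japE 3 w * ‖f w‖ₑ := m1.add m2
    rw [← lintegral_add_left m1, ← lintegral_const_mul _ m12]
    refine (enorm_integral_le_lintegral_enorm _).trans (lintegral_mono fun w => ?_)
    rw [enorm_mul, ← add_mul, ← mul_assoc]
    gcongr
    exact hA v w
  have n1 : Measurable fun v => (∫⁻ w, K (v - w) * ‖f w‖ₑ) * (‖g v‖ₑ * ‖φ v‖ₑ) :=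
    (Measurable.lintegral_prod_right' hKm).mul hgφ
  have n2 : Measurable fun v => (∫⁻ w, japE 3 v * japE 3 w * ‖f w‖ₑ) * (‖g v‖ₑ * ‖φ v‖ₑ) :=
    (Measurable.lintegral_prod_right' hFm).mul hgφ
  have n12 : Measurable fun v => (∫⁻ w, K (v - w) * ‖f w‖ₑ) * (‖g v‖ₑ * ‖φ v‖ₑ) +
      (∫⁻ w, japE 3 v * japE 3 w * ‖f w‖ₑ) * (‖g v‖ₑ * ‖φ v‖ₑ) := n1.add n2
  calc ‖∫ v, kconv A f v * g v * φ v‖ₑ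
      ≤ ∫⁻ v, c * ((∫⁻ w, K (v - w) * ‖f w‖ₑ) * (‖g v‖ₑ * ‖φ v‖ₑ) +
          (∫⁻ w, japE 3 v * japE 3 w * ‖f w‖ₑ) * (‖g v‖ₑ * ‖φ v‖ₑ)) := by
        refine (enorm_integral_le_lintegral_enorm _).trans (lintegral_mono fun v => ?_)
        rw [enorm_mul, enorm_mul, ← add_mul, ← mul_assoc, mul_assoc]
        gcongr
        exact hk v
    _ ≤ _ := by
        rw [lintegral_const_mul _ n12, lintegral_add_left n1]
        gcongr
        exact lintegral_far_le ℓ hf hg hφ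

lemma wE_le_of_sq_wL2_le {ℓ H : ℝ} {φ : 𝓢(V3, ℝ)} (h : wL2 ℓ φ ^ 2 ≤ H) :
    wE ℓ φ ≤ ENNReal.ofReal √H := by
  rw [wE_eq_ofReal_wL2]
  exact ENNReal.ofReal_le_ofReal (Real.le_sqrt_of_sq_le h)

lemma abs_le_of_enorm_le {c : ℝ≥0∞} (hc : c ≠ ∞) (ℓ x H : ℝ) (f g : 𝓢(V3, ℝ))
    (h : ‖x‖ₑ ≤ c * (wE 5 f * wE (5 - ℓ) g * ENNReal.ofReal √H)) :
    |x| ≤ c.toReal * (wL2 5 f * wL2 (5 - ℓ) g * √H) := by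
  have h5 : 0 ≤ wL2 5 f := Real.sqrt_nonneg _
  have hg : 0 ≤ wL2 (5 - ℓ) g := Real.sqrt_nonneg _
  rw [wE_eq_ofReal_wL2, wE_eq_ofReal_wL2, ← ENNReal.ofReal_mul h5,
    ← ENNReal.ofReal_mul (by positivity), ← ENNReal.ofReal_toReal hc,
    ← ENNReal.ofReal_mul ENNReal.toReal_nonneg, Real.enorm_eq_ofReal_abs,
    ENNReal.ofReal_le_ofReal_iff (by positivity)] at h
  exact h

section estimates

variable {γ : ℝ} (hγl : -3 ≤ γ) (hγu : γ ≤ 1) (ℓ : ℝ)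

include hγl hγu

lemma exists_abs_integral_regA_le : ∃ c : ℝ, 0 ≤ c ∧ ∀ (f g h : 𝓢(V3, ℝ)) (i j : Fin 3),
    |∫ v, kconv (regA γ 0 i j) f v * g v * sd j (sd i h) v| ≤
      c * (wL2 5 f * wL2 (5 - ℓ) g * √(H2Sq ℓ h)) := by
  set c : ℝ≥0∞ := 16 * (en2 (fun u => ENNReal.ofReal (sqrtSingKer u)) + en2 (japE (-2))) with hc
  have hct : c ≠ ∞ := ENNReal.mul_ne_top (by norm_num)
    (ENNReal.add_ne_top.2 ⟨en2_sqrtSingKer_ne_top, en2_japE_neg_two_ne_top⟩)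
  refine ⟨c.toReal, ENNReal.toReal_nonneg, fun f g h i j => abs_le_of_enorm_le hct _ _ _ _ _ ?_⟩
  have hk : ∀ u, |regA γ 0 i j u| ≤ 16 * sqrtSingKer u + 8 * (1 + ‖u‖ ^ 3) := fun u => by
    refine (abs_regA_le hγl hγu le_rfl zero_le_one i j u).trans ?_
    have hr := norm_nonneg u
    have h1 : ‖u‖⁻¹ ≤ 4 * sqrtSingKer u + 1 := by
      rcases le_total ‖u‖ 1 with hu | hu
      · have : 1 ≤ 4 * ((1 + ‖u‖) ^ 2)⁻¹ := by
          rw [← div_eq_mul_inv, one_le_div (by positivity)]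
          nlinarith
        have := mul_le_mul_of_nonneg_left this (inv_nonneg.2 hr)
        unfold sqrtSingKer
        linarith
      · have : 0 ≤ sqrtSingKer u := by unfold sqrtSingKer; positivity
        linarith [inv_le_one_of_one_le₀ hu]
    have : 0 ≤ sqrtSingKer u := by unfold sqrtSingKer; positivity
    have : ‖u‖ ^ 2 ≤ 1 + ‖u‖ ^ 3 := by nlinarith [sq_nonneg (‖u‖ - 1)]
    have : 0 ≤ ‖u‖ ^ 3 := by positivity
    linarith
  have hKm : Measurable fun u => ENNReal.ofReal (sqrtSingKer u) :=
    measurable_sqrtSingKer.ennreal_ofReal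
  have hf := f.continuous.measurable
  have hg := g.continuous.measurable
  have hφ := (sd j (sd i h)).continuous.measurable
  calc _ ≤ 16 * (en2 (fun u => ENNReal.ofReal (sqrtSingKer u)) *
          (wE 5 f * wE (5 - ℓ) g * wE ℓ (sd j (sd i h))) +
          en2 (japE (-2)) * (wE 5 f * wE (5 - ℓ) g * wE ℓ (sd j (sd i h)))) :=
        enorm_integral_kconv_mul_mul_le hKm
          (enorm_kernel_le (fun u => by unfold sqrtSingKer; positivity) hk) ℓ hf hg hφ
          (lintegral_sq_kernel_le ℓ hKm hf hg hφ)
    _ = c * (wE 5 f * wE (5 - ℓ) g * wE ℓ (sd j (sd i h))) := by rw [hc]; ring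
    _ ≤ _ := by
        gcongr
        exact wE_le_of_sq_wL2_le (sq_wL2_le_H2Sq ℓ (exists_mderiv_eq_sd_sd i j h))

lemma exists_abs_integral_regB_le : ∃ c : ℝ, 0 ≤ c ∧ ∀ (f g h : 𝓢(V3, ℝ)) (i : Fin 3),
    |∫ v, kconv (regB γ 0 i) f v * g v * sd i h v| ≤
      c * (wL2 5 f * wL2 (5 - ℓ) g * √(H2Sq ℓ h)) := by
  set a : ℝ≥0∞ := (∫⁻ u, ENNReal.ofReal (singKer u)) ^ (1 / 2 : ℝ) *
    ENNReal.ofReal √(24 * (1 + ℓ ^ 2)) with ha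
  have hat : a ≠ ∞ := ENNReal.mul_ne_top
    (ENNReal.rpow_ne_top_of_nonneg (by norm_num) lintegral_singKer_ne_top) ENNReal.ofReal_ne_top
  set c : ℝ≥0∞ := 16 * (a + en2 (japE (-2))) with hc
  have hct : c ≠ ∞ := ENNReal.mul_ne_top (by norm_num)
    (ENNReal.add_ne_top.2 ⟨hat, en2_japE_neg_two_ne_top⟩)
  refine ⟨c.toReal, ENNReal.toReal_nonneg, fun f g h i => abs_le_of_enorm_le hct _ _ _ _ _ ?_⟩
  have hk : ∀ u, |regB γ 0 i u| ≤ 16 * singKer u + 8 * (1 + ‖u‖ ^ 3) := fun u => by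
    refine (abs_regB_le hγl hγu le_rfl zero_le_one i u).trans ?_
    have hr := norm_nonneg u
    have h1 : (‖u‖ ^ 2)⁻¹ ≤ 16 * singKer u + 1 := by
      rcases le_total ‖u‖ 1 with hu | hu
      · have : 1 ≤ 16 * ((1 + ‖u‖) ^ 4)⁻¹ := by
          rw [← div_eq_mul_inv, one_le_div (by positivity)]
          calc (1 + ‖u‖) ^ 4 ≤ (1 + 1) ^ 4 := by gcongr
            _ = 16 := by norm_num
        have := mul_le_mul_of_nonneg_left this (inv_nonneg.2 (sq_nonneg ‖u‖))
        unfold singKer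
        linarith
      · linarith [inv_le_one_of_one_le₀ (one_le_pow₀ hu : 1 ≤ ‖u‖ ^ 2), singKer_nonneg u]
    have : ‖u‖ ^ 2 ≤ 1 + ‖u‖ ^ 3 := by nlinarith [sq_nonneg (‖u‖ - 1)]
    have : ‖u‖ ≤ 1 + ‖u‖ ^ 2 := by nlinarith [sq_nonneg (‖u‖ - 1)]
    have : 0 ≤ ‖u‖ ^ 3 := by positivity
    linarith
  have hKm : Measurable fun u => ENNReal.ofReal (singKer u) := measurable_singKer.ennreal_ofReal
  have hf := f.continuous.measurable
  have hg := g.continuous.measurable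
  have hφ := (sd i h).continuous.measurable
  have h1 := sq_wL2_le_H2Sq ℓ (exists_mderiv_eq_sd i h)
  have hH : ∀ w, ∫⁻ v, ENNReal.ofReal (singKer (v - w)) * (japE ℓ v * ‖sd i h v‖ₑ) ^ 2 ≤
      (ENNReal.ofReal √(24 * (1 + ℓ ^ 2)) * ENNReal.ofReal √(H2Sq ℓ h)) ^ 2 := fun w => by
    rw [mul_pow, ← ENNReal.ofReal_pow (Real.sqrt_nonneg _), ← ENNReal.ofReal_pow
      (Real.sqrt_nonneg _), Real.sq_sqrt (by positivity), Real.sq_sqrt ((sq_nonneg _).trans h1),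
      ← ENNReal.ofReal_mul (by positivity)]
    refine le_trans (lintegral_mono fun v => ?_) (lintegral_hardy_weighted_le ℓ (sd i h) h1
      (fun j => sq_wL2_le_H2Sq ℓ (exists_mderiv_eq_sd_sd i j h)) w)
    gcongr
    exact mul_le_of_le_one_right (by positivity)
      (inv_le_one_of_one_le₀ (one_le_pow₀ (by linarith [norm_nonneg (v - w)])))
  calc _ ≤ 16 * ((∫⁻ u, ENNReal.ofReal (singKer u)) ^ (1 / 2 : ℝ) * (wE 5 f * wE (5 - ℓ) g *
            (ENNReal.ofReal √(24 * (1 + ℓ ^ 2)) * ENNReal.ofReal √(H2Sq ℓ h))) +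
          en2 (japE (-2)) * (wE 5 f * wE (5 - ℓ) g * wE ℓ (sd i h))) :=
        enorm_integral_kconv_mul_mul_le hKm (enorm_kernel_le singKer_nonneg hk) ℓ hf hg hφ
          (lintegral_hardy_kernel_le ℓ hKm hH hf hg hφ)
    _ ≤ 16 * ((∫⁻ u, ENNReal.ofReal (singKer u)) ^ (1 / 2 : ℝ) * (wE 5 f * wE (5 - ℓ) g *
            (ENNReal.ofReal √(24 * (1 + ℓ ^ 2)) * ENNReal.ofReal √(H2Sq ℓ h))) +
          en2 (japE (-2)) * (wE 5 f * wE (5 - ℓ) g * ENNReal.ofReal √(H2Sq ℓ h))) := by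
        gcongr
        exact wE_le_of_sq_wL2_le h1
    _ = _ := by rw [hc, ha]; ring

lemma exists_integral_landauQ_mul_le : ∃ C > (0 : ℝ), ∀ f g h : 𝓢(V3, ℝ),
    ∫ v, LandauQ γ f g v * h v ≤ C * wL2 5 f * wL2 (5 - ℓ) g * √(H2Sq ℓ h) := by
  obtain ⟨a, ha, hA⟩ := exists_abs_integral_regA_le hγl hγu ℓ
  obtain ⟨b, hb, hB⟩ := exists_abs_integral_regB_le hγl hγu ℓ
  refine ⟨9 * a + 12 * b + 1, by positivity, fun f g h => ?_⟩
  rw [integral_landauQ_mul hγl hγu]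
  set P := wL2 5 f * wL2 (5 - ℓ) g * √(H2Sq ℓ h) with hPdef
  have hP : 0 ≤ P := mul_nonneg (mul_nonneg (Real.sqrt_nonneg _) (Real.sqrt_nonneg _))
    (Real.sqrt_nonneg _)
  calc _ ≤ ∑ _i : Fin 3, ∑ _j : Fin 3, a * P + ∑ _i : Fin 3, 4 * (b * P) := by
        refine add_le_add (Finset.sum_le_sum fun i _ => Finset.sum_le_sum fun j _ =>
          (le_abs_self _).trans (hA f g h i j)) (Finset.sum_le_sum fun i _ => ?_)
        linarith [neg_le_abs (∫ v, kconv (regB γ 0 i) f v * g v * sd i h v), hB f g h i]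
    _ ≤ (9 * a + 12 * b + 1) * P := by
        simp only [Fin.sum_univ_three]
        linarith
    _ = _ := by rw [hPdef]; ring

end estimates

/-- Lemma 2.1 (last two estimates, Landau case): with all derivatives on `h`,
`(Q(f,g), h) ≤ C ‖f‖_{L²₅} ‖g‖_{L²} ‖h‖_{H²₅}` and
`(Q(f,g), h) ≤ C ‖f‖_{L²₅} ‖g‖_{L²₁₀} ‖h‖_{H²₋₅}`. -/
theorem landauQ_derivatives_on_h (γ : ℝ) (hγl : -3 ≤ γ) (hγu : γ ≤ 1) :
    ∃ C > (0 : ℝ), ∀ f g h : SchwartzMap (EuclideanSpace ℝ (Fin 3)) ℝ,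
      ((∫ v, LandauQ γ (⇑f) (⇑g) v * h v) ≤
        C * wL2 5 (⇑f) * wL2 0 (⇑g) * Real.sqrt (H2Sq 5 (⇑h))) ∧
      ((∫ v, LandauQ γ (⇑f) (⇑g) v * h v) ≤
        C * wL2 5 (⇑f) * wL2 10 (⇑g) * Real.sqrt (H2Sq (-5) (⇑h))) := by
  obtain ⟨a, ha, hA⟩ := exists_integral_landauQ_mul_le hγl hγu 5
  obtain ⟨b, hb, hB⟩ := exists_integral_landauQ_mul_le hγl hγu (-5)
  have hn : ∀ s F, 0 ≤ wL2 s F := fun _ _ => Real.sqrt_nonneg _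
  refine ⟨max a b, lt_max_of_lt_left ha, fun f g h => ⟨(hA f g h).trans ?_, (hB f g h).trans ?_⟩⟩
  · rw [sub_self]
    gcongr
    exacts [hn _ _, hn _ _, le_max_left a b]
  · rw [show (5 : ℝ) - -5 = 10 by norm_num]
    gcongr
    exacts [hn _ _, hn _ _, le_max_right a b]
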